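/- arXiv:1610.06005 — 2 statements merged into one kernel-verified Lean document; each statement's English description precedes it below -/
import Mathlib

section
/- Let n ≥ 2, let δ > 0, and let R^(1) and R^(2) be proper rigid n-systems of the same mesh δ. Suppose that F(R^(1), e_1) and F(R^(2), e_1) have at least one point in common. Then there exists a proper rigid n-system R of mesh δ such that F(R) = F(R^(1)) ∪ F(R^(2)). -/
open Filter Set Pointwise Topology

noncomputable section

/-- Points of `ℝ^n`. -/
abbrev RVec (n : ℕ) := Fin n → ℝ

/-- The vector of `ℝ^n` with a `1` in position `j` (0-based) and `0` elsewhere;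
`eVec n 0` is the first canonical basis vector `e_1`. -/
def eVec (n : ℕ) (j : ℕ) : RVec n := fun i => if (i : ℕ) = j then 1 else 0

/-- `P` is an `n`-system on the subinterval `I` of `[0,∞)`:
`I` is an order-connected subset of `[0,∞)` with nonempty interior, and conditions
(S1), (S2), (S3) hold at every `q ∈ I`. -/
def IsNSystem (n : ℕ) (I : Set ℝ) (P : ℝ → RVec n) : Prop :=
  I ⊆ Set.Ici (0 : ℝ) ∧ I.OrdConnected ∧ (interior I).Nonempty ∧
  ∀ q ∈ I,
    ((∀ i, 0 ≤ P q i) ∧ Monotone (P q) ∧ (∑ i, P q i) = q) ∧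
    ∃ ε > (0 : ℝ), ∃ k ℓ : Fin n,
      (∀ t ∈ I ∩ Set.Icc (q - ε) q, P t = P q + (t - q) • eVec n ℓ) ∧
      (∀ t ∈ I ∩ Set.Icc q (q + ε), P t = P q + (t - q) • eVec n k) ∧
      (q ∈ interior I → ℓ < k → ∀ i : Fin n, ℓ ≤ i → i ≤ k → P q i = P q ℓ)

/-- `P` is a proper `n`-system on `I`: it is an `n`-system whose first component is
unbounded (by the monotonicity (S1) of the components, this is equivalent to all
components simultaneously exceeding any given bound). -/
def IsProperSys (n : ℕ) (I : Set ℝ) (P : ℝ → RVec n) : Prop :=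
  IsNSystem n I P ∧ ∀ M : ℝ, ∃ q ∈ I, ∀ i, M < P q i

/-- The set `F(P)` of limits of `q_i⁻¹ • P(q_i)` along strictly increasing unbounded
sequences `(q_i)` in `I`. -/
def FSet (n : ℕ) (I : Set ℝ) (P : ℝ → RVec n) : Set (RVec n) :=
  {x | ∃ q : ℕ → ℝ, (∀ i, q i ∈ I) ∧ StrictMono q ∧
    Tendsto q atTop atTop ∧ Tendsto (fun i => (q i)⁻¹ • P (q i)) atTop (𝓝 x)}

/-- The set `F(P, e₁)`: as `F(P)`, but with the extra requirement that the right
derivative of `P` at each `q_i` is the first basis vector `e_1`. -/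
def FSetE1 (n : ℕ) (I : Set ℝ) (P : ℝ → RVec n) : Set (RVec n) :=
  {x | ∃ q : ℕ → ℝ, (∀ i, q i ∈ I) ∧ StrictMono q ∧ Tendsto q atTop atTop ∧
    (∀ i, ∃ ε > (0 : ℝ), ∀ t ∈ I ∩ Set.Icc (q i) (q i + ε),
      P t = P (q i) + (t - q i) • eVec n 0) ∧
    Tendsto (fun i => (q i)⁻¹ • P (q i)) atTop (𝓝 x)}

/-- `q` is a switch number of the `n`-system `P` on `I`: a point of `I` on the boundary
of `I`, or an interior point where the local slopes `e_k` (right) and `e_ℓ` (left)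
from (S2) satisfy `k < ℓ`. -/
def IsSwitchNumber (n : ℕ) (I : Set ℝ) (P : ℝ → RVec n) (q : ℝ) : Prop :=
  q ∈ I ∧ (q ∈ frontier I ∨
    (q ∈ interior I ∧ ∃ ε > (0 : ℝ), ∃ k ℓ : Fin n, k < ℓ ∧
      (∀ t ∈ I ∩ Set.Icc (q - ε) q, P t = P q + (t - q) • eVec n ℓ) ∧
      (∀ t ∈ I ∩ Set.Icc q (q + ε), P t = P q + (t - q) • eVec n k)))

/-- `q` is a division number of the `n`-system `P` on `I`: a point of `I` on the boundary
of `I`, or an interior point where `P` is not differentiable, i.e. where the left and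
right slopes from (S2) differ. -/
def IsDivisionNumber (n : ℕ) (I : Set ℝ) (P : ℝ → RVec n) (q : ℝ) : Prop :=
  q ∈ I ∧ (q ∈ frontier I ∨
    (q ∈ interior I ∧ ∃ ε > (0 : ℝ), ∃ k ℓ : Fin n, k ≠ ℓ ∧
      (∀ t ∈ I ∩ Set.Icc (q - ε) q, P t = P q + (t - q) • eVec n ℓ) ∧
      (∀ t ∈ I ∩ Set.Icc q (q + ε), P t = P q + (t - q) • eVec n k)))

/-- A non-degenerate `n`-system: an `n`-system whose domain is a closed subinterval
of `(0,∞)` and whose switch points all have `n` distinct positive coordinates. -/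
def IsNonDegenerate (n : ℕ) (I : Set ℝ) (P : ℝ → RVec n) : Prop :=
  IsNSystem n I P ∧ IsClosed I ∧ I ⊆ Set.Ioi (0 : ℝ) ∧
  ∀ q, IsSwitchNumber n I P q → (∀ i, 0 < P q i) ∧ StrictMono (P q)

/-- A rigid `n`-system of mesh `δ`: a non-degenerate `n`-system whose switch points
belong to `δℤ^n`. -/
def IsRigid (n : ℕ) (δ : ℝ) (I : Set ℝ) (P : ℝ → RVec n) : Prop :=
  IsNonDegenerate n I P ∧
  ∀ q, IsSwitchNumber n I P q → ∀ i, ∃ m : ℤ, P q i = δ * m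

/-- A self-similar system: the domain is unbounded and there is `ρ > 1` with
`P(ρq) = ρ • P(q)` for all `q` in the domain. -/
def IsSelfSimilar (n : ℕ) (I : Set ℝ) (P : ℝ → RVec n) : Prop :=
  ¬ BddAbove I ∧ ∃ ρ : ℝ, 1 < ρ ∧ ∀ q ∈ I, ρ * q ∈ I ∧ P (ρ * q) = ρ • P q

/-- The cube `[-ε, ε]^n`. -/
def cubeNbhd (n : ℕ) (ε : ℝ) : Set (RVec n) := {y | ∀ i, |y i| ≤ ε}

/-- The distance `dist(E, F)`: the infimum of all `ε > 0` such that
`E ⊆ F + [-ε,ε]^n` and `F ⊆ E + [-ε,ε]^n`. -/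
def cubeDist (n : ℕ) (E F : Set (RVec n)) : ℝ :=
  sInf {ε : ℝ | 0 < ε ∧ E ⊆ F + cubeNbhd n ε ∧ F ⊆ E + cubeNbhd n ε}

/-- `μ_T(P)`: the point of `ℝ^m` whose `j`-th coordinate is
`liminf_{q → ∞, q ∈ I} T_j(P(q))/q`. -/
def muT (n m : ℕ) (T : RVec n → RVec m) (I : Set ℝ) (P : ℝ → RVec n) : RVec m :=
  fun j => Filter.liminf (fun q => T (P q) j / q) (atTop ⊓ 𝓟 I)

/-- `liminf` of a sequence of subsets of `ℝ^n`: the set of limits of convergent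
sequences `(x_i)` with `x_i ∈ F i` for every `i`. -/
def setLiminf (n : ℕ) (F : ℕ → Set (RVec n)) : Set (RVec n) :=
  {x | ∃ y : ℕ → RVec n, (∀ i, y i ∈ F i) ∧ Tendsto y atTop (𝓝 x)}

/-- `limsup` of a sequence of subsets of `ℝ^n`: the set of accumulation points of
sequences `(x_i)` with `x_i ∈ F i` for every `i`, i.e. limits of convergent
subsequences. -/
def setLimsup (n : ℕ) (F : ℕ → Set (RVec n)) : Set (RVec n) :=
  {x | ∃ (y : ℕ → RVec n) (φ : ℕ → ℕ), (∀ i, y i ∈ F i) ∧ StrictMono φ ∧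
    Tendsto (y ∘ φ) atTop (𝓝 x)}

/-- `P` moves along `e_{k+1}` immediately to the right of `q`. -/
def RightSlope {n : ℕ} (P : ℝ → RVec n) (q : ℝ) (k : Fin n) : Prop :=
  ∀ᶠ t in 𝓝[≥] q, P t = P q + (t - q) • eVec n k

/-- `P` moves along `e_{ℓ+1}` immediately to the left of `q`. -/
def LeftSlope {n : ℕ} (P : ℝ → RVec n) (q : ℝ) (ℓ : Fin n) : Prop :=
  ∀ᶠ t in 𝓝[≤] q, P t = P q + (t - q) • eVec n ℓ

/-- `v` has strictly increasing coordinates, all in `δℤ`. -/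
def IsLatticePt {n : ℕ} (δ : ℝ) (v : RVec n) : Prop :=
  StrictMono v ∧ ∀ i, ∃ m : ℤ, v i = δ * m

/-- The local conditions at `q` satisfied by a rigid system of mesh `δ`, apart from positivity. -/
def LocallyRigidAt {n : ℕ} (δ : ℝ) (P : ℝ → RVec n) (q : ℝ) : Prop :=
  ∃ k ℓ : Fin n, LeftSlope P q ℓ ∧ RightSlope P q k ∧
    (ℓ < k → ∀ i : Fin n, ℓ ≤ i → i ≤ k → P q i = P q ℓ) ∧
    (k < ℓ → IsLatticePt δ (P q))

/-- A rigid system extended to the whole real line, with no sign condition on the coordinates. -/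
structure IsGlobalSys {n : ℕ} (δ : ℝ) (P : ℝ → RVec n) : Prop where
  sum_eq : ∀ t, ∑ i, P t i = t
  mono : ∀ t, Monotone (P t)
  locallyRigid : ∀ t, LocallyRigidAt δ P t

lemma eVec_self {n : ℕ} (k : Fin n) : eVec n k k = 1 := by simp [eVec]

lemma eVec_of_ne {n : ℕ} {k i : Fin n} (h : i ≠ k) : eVec n k i = 0 := by
  simp [eVec, Fin.val_inj, h]

lemma eVec_nonneg {n : ℕ} (k : ℕ) (i : Fin n) : 0 ≤ eVec n k i := by
  unfold eVec; split_ifs <;> norm_num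

lemma sum_eVec {n : ℕ} (k : Fin n) : ∑ i, eVec n k i = 1 := by
  rw [Finset.sum_eq_single k] <;> simp +contextual [eVec_self, eVec_of_ne]

lemma line_apply {n : ℕ} (v : RVec n) (c : ℝ) (k : ℕ) (i : Fin n) :
    (v + c • eVec n k) i = v i + c * eVec n k i := by simp

lemma line_add_line {n : ℕ} (v : RVec n) (c d : ℝ) (k : ℕ) :
    v + c • eVec n k + d • eVec n k = v + (c + d) • eVec n k := by
  rw [add_smul, add_assoc]

lemma RightSlope.continuousWithinAt {n : ℕ} {P : ℝ → RVec n} {q : ℝ} {k : Fin n}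
    (h : RightSlope P q k) : ContinuousWithinAt P (Ici q) q := by
  have hc : Continuous fun t : ℝ => P q + (t - q) • eVec n k := by fun_prop
  exact hc.continuousWithinAt.congr_of_eventuallyEq h (by simp)

lemma LeftSlope.continuousWithinAt {n : ℕ} {P : ℝ → RVec n} {q : ℝ} {k : Fin n}
    (h : LeftSlope P q k) : ContinuousWithinAt P (Iic q) q := by
  have hc : Continuous fun t : ℝ => P q + (t - q) • eVec n k := by fun_prop
  exact hc.continuousWithinAt.congr_of_eventuallyEq h (by simp)

lemma RightSlope.unique {n : ℕ} {P : ℝ → RVec n} {q : ℝ} {k k' : Fin n}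
    (h : RightSlope P q k) (h' : RightSlope P q k') : k = k' := by
  by_contra hne
  have h1 : ∀ᶠ t in 𝓝[>] q, P t = P q + (t - q) • eVec n k :=
    h.filter_mono (nhdsWithin_mono _ Ioi_subset_Ici_self)
  have h2 : ∀ᶠ t in 𝓝[>] q, P t = P q + (t - q) • eVec n k' :=
    h'.filter_mono (nhdsWithin_mono _ Ioi_subset_Ici_self)
  obtain ⟨t, ⟨h3, h4⟩, h5⟩ := ((h1.and h2).and self_mem_nhdsWithin).exists
  have h6 := congrFun (h3.symm.trans h4) k
  rw [line_apply, line_apply, eVec_self, eVec_of_ne hne] at h6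
  have : q < t := h5
  linarith

lemma LeftSlope.unique {n : ℕ} {P : ℝ → RVec n} {q : ℝ} {k k' : Fin n}
    (h : LeftSlope P q k) (h' : LeftSlope P q k') : k = k' := by
  by_contra hne
  have h1 : ∀ᶠ t in 𝓝[<] q, P t = P q + (t - q) • eVec n k :=
    h.filter_mono (nhdsWithin_mono _ Iio_subset_Iic_self)
  have h2 : ∀ᶠ t in 𝓝[<] q, P t = P q + (t - q) • eVec n k' :=
    h'.filter_mono (nhdsWithin_mono _ Iio_subset_Iic_self)
  obtain ⟨t, ⟨h3, h4⟩, h5⟩ := ((h1.and h2).and self_mem_nhdsWithin).exists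
  have h6 := congrFun (h3.symm.trans h4) k
  rw [line_apply, line_apply, eVec_self, eVec_of_ne hne] at h6
  have : t < q := h5
  linarith

lemma continuousOn_of_slopes {n : ℕ} {P : ℝ → RVec n} {a : ℝ}
    (hR : ∀ t, a ≤ t → ∃ k, RightSlope P t k) (hL : ∀ t, a < t → ∃ k, LeftSlope P t k) :
    ContinuousOn P (Ici a) := by
  intro t ht
  obtain ⟨k, hk⟩ := hR t ht
  rcases eq_or_lt_of_le (show a ≤ t from ht) with rfl | hlt
  · exact hk.continuousWithinAt
  · obtain ⟨l, hl⟩ := hL t hlt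
    exact (continuousAt_iff_continuous_left_right.2
      ⟨hl.continuousWithinAt, hk.continuousWithinAt⟩).continuousWithinAt

lemma coord_le_of_slopes {n : ℕ} {P : ℝ → RVec n} {a : ℝ}
    (hR : ∀ t, a ≤ t → ∃ k, RightSlope P t k) (hL : ∀ t, a < t → ∃ k, LeftSlope P t k)
    {s t : ℝ} (has : a ≤ s) (hst : s ≤ t) (i : Fin n) : P s i ≤ P t i := by
  have hc : ContinuousOn (fun u => P u i) (Icc s t) :=
    ((continuous_apply i).comp_continuousOn (continuousOn_of_slopes hR hL)).mono
      fun u hu => has.trans hu.1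
  have hcl : IsClosed ({u | P s i ≤ P u i} ∩ Icc s t) := by
    rw [inter_comm]
    exact hc.preimage_isClosed_of_isClosed isClosed_Icc isClosed_Ici
  refine hcl.Icc_subset_of_forall_exists_gt (by simp) ?_ (right_mem_Icc.2 hst)
  rintro u ⟨hu1, hu2⟩ y hy
  obtain ⟨k, hk⟩ := hR u (has.trans hu2.1)
  have h1 : ∀ᶠ t in 𝓝[>] u, P t = P u + (t - u) • eVec n k :=
    hk.filter_mono (nhdsWithin_mono _ Ioi_subset_Ici_self)
  obtain ⟨v, hv1, hv2⟩ := (h1.and (Ioc_mem_nhdsGT (show u < y from hy))).exists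
  refine ⟨v, ?_, hv2⟩
  have : P u i ≤ P v i := by
    rw [hv1, line_apply]
    have := mul_nonneg (sub_nonneg.2 hv2.1.le) (eVec_nonneg (k : ℕ) i)
    linarith
  exact le_trans hu1 this

namespace IsGlobalSys

variable {n : ℕ} {δ : ℝ} {P : ℝ → RVec n}

lemma exists_rightSlope (h : IsGlobalSys δ P) (t : ℝ) : ∃ k, RightSlope P t k :=
  let ⟨k, _, _, hk, _⟩ := h.locallyRigid t
  ⟨k, hk⟩

lemma exists_leftSlope (h : IsGlobalSys δ P) (t : ℝ) : ∃ k, LeftSlope P t k :=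
  let ⟨_, l, hl, _⟩ := h.locallyRigid t
  ⟨l, hl⟩

lemma continuous (h : IsGlobalSys δ P) : Continuous P := by
  refine continuous_iff_continuousAt.2 fun t => ?_
  obtain ⟨k, hk⟩ := h.exists_rightSlope t
  obtain ⟨l, hl⟩ := h.exists_leftSlope t
  exact continuousAt_iff_continuous_left_right.2 ⟨hl.continuousWithinAt, hk.continuousWithinAt⟩

lemma coord_mono (h : IsGlobalSys δ P) (i : Fin n) : Monotone fun t => P t i :=
  fun s _ hst => coord_le_of_slopes (a := s) (fun t _ => h.exists_rightSlope t)
    (fun t _ => h.exists_leftSlope t) le_rfl hst i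

end IsGlobalSys

lemma LeftSlope.congr {n : ℕ} {P U : ℝ → RVec n} {q : ℝ} {k : Fin n} (h : LeftSlope P q k)
    (hU : U =ᶠ[𝓝[≤] q] P) : LeftSlope U q k := by
  have hq : U q = P q := hU.self_of_nhdsWithin self_mem_Iic
  filter_upwards [h, hU] with t h1 h2
  rw [h2, hq, h1]

lemma RightSlope.congr {n : ℕ} {P U : ℝ → RVec n} {q : ℝ} {k : Fin n} (h : RightSlope P q k)
    (hU : U =ᶠ[𝓝[≥] q] P) : RightSlope U q k := by
  have hq : U q = P q := hU.self_of_nhdsWithin self_mem_Ici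
  filter_upwards [h, hU] with t h1 h2
  rw [h2, hq, h1]

lemma LocallyRigidAt.congr {n : ℕ} {δ : ℝ} {P U : ℝ → RVec n} {q : ℝ}
    (h : LocallyRigidAt δ P q) (hU : U =ᶠ[𝓝 q] P) : LocallyRigidAt δ U q := by
  obtain ⟨k, l, h1, h2, h3, h4⟩ := h
  have hq : U q = P q := hU.self_of_nhds
  refine ⟨k, l, h1.congr (hU.filter_mono nhdsWithin_le_nhds),
    h2.congr (hU.filter_mono nhdsWithin_le_nhds), ?_, ?_⟩
  · rwa [hq]
  · rwa [hq]

/-- The path following `P` up to `q` and `U` afterwards. -/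
def glue {n : ℕ} (P U : ℝ → RVec n) (q : ℝ) : ℝ → RVec n := fun t => if t ≤ q then P t else U t

lemma glue_of_le {n : ℕ} {P U : ℝ → RVec n} {q t : ℝ} (h : t ≤ q) : glue P U q t = P t :=
  if_pos h

lemma glue_of_ge {n : ℕ} {P U : ℝ → RVec n} {q t : ℝ} (hq : P q = U q) (h : q ≤ t) :
    glue P U q t = U t := by
  rcases eq_or_lt_of_le h with rfl | h
  · rw [glue_of_le le_rfl, hq]
  · exact if_neg h.not_ge

lemma isGlobalSys_glue {n : ℕ} [NeZero n] {δ : ℝ} {P U : ℝ → RVec n} {q : ℝ} (hq : P q = U q)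
    (hPs : ∀ t ≤ q, ∑ i, P t i = t) (hUs : ∀ t ≥ q, ∑ i, U t i = t)
    (hPm : ∀ t ≤ q, Monotone (P t)) (hUm : ∀ t ≥ q, Monotone (U t))
    (hP : ∀ t < q, LocallyRigidAt δ P t) (hU : ∀ t > q, LocallyRigidAt δ U t)
    (hl : ∃ l, LeftSlope P q l) (hr : RightSlope U q 0) (hlat : IsLatticePt δ (P q)) :
    IsGlobalSys δ (glue P U q) := by
  refine ⟨fun t => ?_, fun t => ?_, fun t => ?_⟩
  · rcases le_total t q with h | h
    · rw [glue_of_le h, hPs t h]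
    · rw [glue_of_ge hq h, hUs t h]
  · rcases le_total t q with h | h
    · rw [glue_of_le h]; exact hPm t h
    · rw [glue_of_ge hq h]; exact hUm t h
  · rcases lt_trichotomy t q with h | rfl | h
    · refine (hP t h).congr ?_
      filter_upwards [Iio_mem_nhds h] with s hs
      exact glue_of_le (le_of_lt hs)
    · obtain ⟨l, hl⟩ := hl
      refine ⟨0, l, hl.congr ?_, hr.congr ?_, fun h => absurd h (Fin.not_lt_zero _), fun _ => ?_⟩
      · filter_upwards [self_mem_nhdsWithin] with s hs
        exact glue_of_le hs
      · filter_upwards [self_mem_nhdsWithin] with s hs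
        exact glue_of_ge hq hs
      · rwa [glue_of_le le_rfl]
    · refine (hU t h).congr ?_
      filter_upwards [Ioi_mem_nhds h] with s hs
      exact glue_of_ge hq (le_of_lt hs)

/-- The line through `v` in the direction `e₁`, parametrized by the sum of the coordinates. -/
def lineFrom {n : ℕ} (q : ℝ) (v : RVec n) : ℝ → RVec n := fun t => v + (t - q) • eVec n 0

lemma lineFrom_self {n : ℕ} (q : ℝ) (v : RVec n) : lineFrom q v q = v := by simp [lineFrom]

lemma sum_lineFrom {n : ℕ} [NeZero n] {q : ℝ} {v : RVec n} (hv : ∑ i, v i = q) (t : ℝ) :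
    ∑ i, lineFrom q v t i = t := by
  have := sum_eVec (0 : Fin n)
  rw [Fin.val_zero] at this
  simp only [lineFrom, line_apply, Finset.sum_add_distrib, ← Finset.mul_sum, hv, this]
  ring

lemma monotone_lineFrom {n : ℕ} [NeZero n] {q t : ℝ} {v : RVec n} (hv : Monotone v)
    (ht : t ≤ q) : Monotone (lineFrom q v t) := by
  intro i j hij
  simp only [lineFrom, line_apply]
  have h1 := hv hij
  have : eVec n 0 j ≤ eVec n 0 i := by
    unfold eVec
    have : (i : ℕ) ≤ j := hij
    split_ifs <;> first | omega | norm_num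
  nlinarith

lemma lineFrom_eq {n : ℕ} (q : ℝ) (v : RVec n) (s t : ℝ) :
    lineFrom q v t = lineFrom q v s + (t - s) • eVec n 0 := by
  rw [lineFrom, lineFrom, line_add_line]
  congr 2; ring

lemma leftSlope_lineFrom {n : ℕ} [NeZero n] (q : ℝ) (v : RVec n) (t : ℝ) :
    LeftSlope (lineFrom q v) t 0 :=
  Eventually.of_forall fun s => by rw [Fin.val_zero]; exact lineFrom_eq q v t s

lemma rightSlope_lineFrom {n : ℕ} [NeZero n] (q : ℝ) (v : RVec n) (t : ℝ) :
    RightSlope (lineFrom q v) t 0 :=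
  Eventually.of_forall fun s => by rw [Fin.val_zero]; exact lineFrom_eq q v t s

lemma locallyRigidAt_lineFrom {n : ℕ} [NeZero n] (δ q : ℝ) (v : RVec n) (t : ℝ) :
    LocallyRigidAt δ (lineFrom q v) t :=
  ⟨0, 0, leftSlope_lineFrom q v t, rightSlope_lineFrom q v t, fun h => absurd h (lt_irrefl _),
    fun h => absurd h (lt_irrefl _)⟩

/-- Replacing the part of a system before a lattice point by a line. -/
lemma isGlobalSys_glue_lineFrom {n : ℕ} [NeZero n] {δ : ℝ} {P : ℝ → RVec n} {q : ℝ}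
    (hs : ∀ t ≥ q, ∑ i, P t i = t) (hm : ∀ t ≥ q, Monotone (P t))
    (hP : ∀ t > q, LocallyRigidAt δ P t) (hr : RightSlope P q 0) (hlat : IsLatticePt δ (P q)) :
    IsGlobalSys δ (glue (lineFrom q (P q)) P q) :=
  isGlobalSys_glue (lineFrom_self _ _) (fun t _ => sum_lineFrom (hs q le_rfl) t) hs
    (fun _ ht => monotone_lineFrom (hm q le_rfl) ht) hm
    (fun t _ => locallyRigidAt_lineFrom _ _ _ t) hP ⟨0, leftSlope_lineFrom _ _ _⟩ hr
    (by rwa [lineFrom_self])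

lemma eq_add_smul_eVec {n : ℕ} {v w : RVec n} {k : Fin n} (h : ∀ i, i ≠ k → v i = w i) :
    v = w + (∑ i, v i - ∑ i, w i) • eVec n k := by
  have h1 : ∑ i, v i - ∑ i, w i = v k - w k := by
    rw [← Finset.sum_sub_distrib, Finset.sum_eq_single k]
    · intro i _ hi; rw [h i hi, sub_self]
    · simp
  ext i
  rw [line_apply, h1]
  by_cases hi : i = k
  · subst hi; rw [eVec_self]; ring
  · rw [eVec_of_ne hi, h i hi]; ring

namespace IsGlobalSys

variable {n : ℕ} {δ : ℝ} {P : ℝ → RVec n}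

lemma exists_sum_orderIso [NeZero n] (h : IsGlobalSys δ P) (φ : ℝ ≃o ℝ) :
    ∃ τ : ℝ ≃o ℝ, ∀ t, τ t = ∑ i, φ (P t i) := by
  have hmono : StrictMono fun t => ∑ i, φ (P t i) := by
    intro s t hst
    have h1 : ∑ i, P s i < ∑ i, P t i := by rwa [h.sum_eq, h.sum_eq]
    obtain ⟨j, hj, hlt⟩ := Finset.exists_lt_of_sum_lt h1
    exact Finset.sum_lt_sum (fun i _ => φ.monotone (h.coord_mono i hst.le))
      ⟨j, hj, φ.strictMono hlt⟩
  have hcont : Continuous fun t => ∑ i, φ (P t i) :=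
    continuous_finsetSum _ fun i _ => φ.continuous.comp ((continuous_apply i).comp h.continuous)
  have hn : (0 : ℝ) < n := Nat.cast_pos.2 (NeZero.pos n)
  have htop : Tendsto (fun t => ∑ i, φ (P t i)) atTop atTop := by
    refine tendsto_atTop_mono' _ ?_ (tendsto_atTop_add_const_right _
      (∑ i, (φ (P 0 i) - |φ (P 0 i)|) - ∑ i, |φ (P 0 i)|) (φ.tendsto_atTop.comp
      (tendsto_id.atTop_div_const hn)))
    filter_upwards [eventually_ge_atTop 0] with t ht
    obtain ⟨j, -, hj⟩ : ∃ j ∈ Finset.univ, t / n ≤ P t j := by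
      refine Finset.exists_le_of_sum_le (s := Finset.univ) ⟨0, Finset.mem_univ _⟩ ?_
      rw [h.sum_eq]; simp; field_simp; exact le_rfl
    have h1 : ∑ i, φ (P 0 i) - φ (P 0 j) ≤ ∑ i, φ (P t i) - φ (P t j) := by
      rw [← Finset.sum_erase_eq_sub (Finset.mem_univ j),
        ← Finset.sum_erase_eq_sub (Finset.mem_univ j)]
      exact Finset.sum_le_sum fun i _ => φ.monotone (h.coord_mono i ht)
    have h2 := φ.monotone hj
    have h3 : φ (P 0 j) ≤ ∑ i, |φ (P 0 i)| :=
      (le_abs_self _).trans (Finset.single_le_sum (f := fun i => |φ (P 0 i)|)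
        (fun i _ => abs_nonneg _) (Finset.mem_univ j))
    have h4 : 0 ≤ ∑ i, |φ (P 0 i)| := Finset.sum_nonneg fun i _ => abs_nonneg _
    simp only [Function.comp, id, Finset.sum_sub_distrib]
    linarith
  have hbot : Tendsto (fun t => ∑ i, φ (P t i)) atBot atBot := by
    refine tendsto_atBot_mono' _ ?_ (tendsto_atBot_add_const_right _
      (∑ i, (φ (P 0 i) + |φ (P 0 i)|) + ∑ i, |φ (P 0 i)|) (φ.tendsto_atBot.comp
      (tendsto_id.atBot_div_const hn)))
    filter_upwards [eventually_le_atBot 0] with t ht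
    obtain ⟨j, -, hj⟩ : ∃ j ∈ Finset.univ, P t j ≤ t / n := by
      refine Finset.exists_le_of_sum_le (s := Finset.univ) ⟨0, Finset.mem_univ _⟩ ?_
      rw [h.sum_eq]; simp; field_simp; exact le_rfl
    have h1 : ∑ i, φ (P t i) - φ (P t j) ≤ ∑ i, φ (P 0 i) - φ (P 0 j) := by
      rw [← Finset.sum_erase_eq_sub (Finset.mem_univ j),
        ← Finset.sum_erase_eq_sub (Finset.mem_univ j)]
      exact Finset.sum_le_sum fun i _ => φ.monotone (h.coord_mono i ht)
    have h2 := φ.monotone hj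
    have h3 : -φ (P 0 j) ≤ ∑ i, |φ (P 0 i)| :=
      (neg_le_abs _).trans (Finset.single_le_sum (f := fun i => |φ (P 0 i)|)
        (fun i _ => abs_nonneg _) (Finset.mem_univ j))
    have h4 : 0 ≤ ∑ i, |φ (P 0 i)| := Finset.sum_nonneg fun i _ => abs_nonneg _
    simp only [Function.comp, id, Finset.sum_add_distrib]
    linarith
  exact ⟨hmono.orderIsoOfSurjective _ (hcont.surjective htop hbot), fun t => rfl⟩

private lemma map_eq_of_eq {φ τ : ℝ ≃o ℝ} (hτ : ∀ t, τ t = ∑ i, φ (P t i))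
    {q q' : ℝ} {k : Fin n}
    (hk : P (τ.symm q') = P (τ.symm q) + (τ.symm q' - τ.symm q) • eVec n k) :
    (fun i => φ (P (τ.symm q') i)) = (fun i => φ (P (τ.symm q) i)) + (q' - q) • eVec n k := by
  have hsum : ∀ q, ∑ i, φ (P (τ.symm q) i) = q := fun q => by rw [← hτ, τ.apply_symm_apply]
  have := eq_add_smul_eVec (v := fun i => φ (P (τ.symm q') i))
    (w := fun i => φ (P (τ.symm q) i)) (k := k) fun i hi => by
      have := congrFun hk i
      rw [line_apply, eVec_of_ne hi] at this
      simp [this]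
  simpa only [hsum] using this

lemma leftSlope_map {φ τ : ℝ ≃o ℝ} (hτ : ∀ t, τ t = ∑ i, φ (P t i))
    {q : ℝ} {k : Fin n} (hk : LeftSlope P (τ.symm q) k) :
    LeftSlope (fun q i => φ (P (τ.symm q) i)) q k := by
  have : Tendsto τ.symm (𝓝[≤] q) (𝓝[≤] (τ.symm q)) :=
    tendsto_nhdsWithin_iff.2 ⟨τ.symm.continuous.continuousWithinAt,
      by filter_upwards [self_mem_nhdsWithin] with s hs using τ.symm.monotone hs⟩
  filter_upwards [this.eventually hk] with q' hq' using map_eq_of_eq hτ hq'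

lemma rightSlope_map {φ τ : ℝ ≃o ℝ} (hτ : ∀ t, τ t = ∑ i, φ (P t i))
    {q : ℝ} {k : Fin n} (hk : RightSlope P (τ.symm q) k) :
    RightSlope (fun q i => φ (P (τ.symm q) i)) q k := by
  have : Tendsto τ.symm (𝓝[≥] q) (𝓝[≥] (τ.symm q)) :=
    tendsto_nhdsWithin_iff.2 ⟨τ.symm.continuous.continuousWithinAt,
      by filter_upwards [self_mem_nhdsWithin] with s hs using τ.symm.monotone hs⟩
  filter_upwards [this.eventually hk] with q' hq' using map_eq_of_eq hτ hq'

/-- Applying an increasing bijection which preserves `δℤ` to all the coordinates of a system and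
reparametrizing by the sum of the coordinates yields a system. -/
lemma map (h : IsGlobalSys δ P) {φ τ : ℝ ≃o ℝ} (hτ : ∀ t, τ t = ∑ i, φ (P t i))
    (hφ : ∀ m : ℤ, ∃ m' : ℤ, φ (δ * m) = δ * m') :
    IsGlobalSys δ fun q i => φ (P (τ.symm q) i) := by
  refine ⟨fun q => by rw [← hτ, τ.apply_symm_apply],
    fun q i j hij => φ.monotone (h.mono _ hij), fun q => ?_⟩
  obtain ⟨k, l, h1, h2, h3, h4⟩ := h.locallyRigid (τ.symm q)
  refine ⟨k, l, leftSlope_map hτ h1, rightSlope_map hτ h2,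
    fun hlk i h5 h6 => congrArg φ (h3 hlk i h5 h6), fun hkl =>
    ⟨fun i j hij => φ.strictMono ((h4 hkl).1 hij), fun i => ?_⟩⟩
  obtain ⟨m, hm⟩ := (h4 hkl).2 i
  obtain ⟨m', hm'⟩ := hφ m
  exact ⟨m', by rw [← hm', ← hm]⟩

end IsGlobalSys

lemma exists_orderIso_bend (φ : ℝ ≃o ℝ) (p : ℝ) {s : ℝ} (hs : 0 < s) :
    ∃ ψ : ℝ ≃o ℝ, (∀ t ≥ p, ψ t = φ t) ∧ ∀ t ≤ p, ψ t = φ p + s * (t - p) := by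
  let f : ℝ → ℝ := fun t => if t ≤ p then φ p + s * (t - p) else φ t
  have hf : ∀ t ≤ p, f t = φ p + s * (t - p) := fun t ht => if_pos ht
  have hf' : ∀ t ≥ p, f t = φ t := by
    intro t ht
    rcases eq_or_lt_of_le ht with rfl | ht
    · rw [hf _ le_rfl]; simp
    · exact if_neg ht.not_ge
  have hmono : StrictMono f := by
    refine StrictMonoOn.Iic_union_Ici (a := p) ?_ ?_
    · intro t ht u hu htu
      rw [hf t ht, hf u hu]
      have := mul_lt_mul_of_pos_left htu hs
      linarith
    · intro t ht u hu htu
      rw [hf' t ht, hf' u hu]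
      exact φ.strictMono htu
  have hsurj : Function.Surjective f := by
    intro z
    rcases le_total z (φ p) with h | h
    · have h1 : (z - φ p) / s ≤ 0 := div_nonpos_of_nonpos_of_nonneg (by linarith) hs.le
      refine ⟨p + (z - φ p) / s, ?_⟩
      rw [hf _ (by linarith)]
      field_simp
      ring
    · exact ⟨φ.symm z, by rw [hf' _ (φ.le_symm_apply.2 h), φ.apply_symm_apply]⟩
  exact ⟨hmono.orderIsoOfSurjective _ hsurj, hf', hf⟩

/-- An increasing piecewise linear bijection with positive integer slopes mapping `δ y i` to
`δ A i` and with prescribed slope `σ` after the last of these points. -/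
lemma exists_orderIso_interpolate (δ : ℝ) (N : ℕ) (y A : Fin (N + 1) → ℤ) (hy : StrictMono y)
    (hA : StrictMono A) (hdvd : ∀ i j, i < j → y j - y i ∣ A j - A i) {σ : ℕ} (hσ : 0 < σ)
    (hδ : 0 < δ) :
    ∃ φ : ℝ ≃o ℝ, (∀ m : ℤ, ∃ m' : ℤ, φ (δ * m) = δ * m') ∧ (∀ i, φ (δ * y i) = δ * A i) ∧
      (∀ t ≥ δ * y (Fin.last N), φ t = σ * t + δ * (A (Fin.last N) - σ * y (Fin.last N) : ℤ)) ∧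
      ∀ K : ℝ, (∀ i, |δ * A i - σ * (δ * y i)| ≤ K) → ∀ t ≥ δ * y 0, |φ t - σ * t| ≤ K := by
  induction N with
  | zero =>
    have hσ' : (0 : ℝ) < σ := Nat.cast_pos.2 hσ
    let φ : ℝ ≃o ℝ := (OrderIso.mulLeft₀ (σ : ℝ) hσ').trans
      (OrderIso.addRight (δ * (A 0 - σ * y 0 : ℤ)))
    have hφ : ∀ t, φ t = σ * t + δ * (A 0 - σ * y 0 : ℤ) := fun t => rfl
    refine ⟨φ, fun m => ⟨σ * m + (A 0 - σ * y 0), ?_⟩, fun i => ?_, fun t _ => hφ t,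
      fun K hK t _ => ?_⟩
    · rw [hφ]; push_cast; ring
    · rw [show i = 0 from Fin.ext (by omega), hφ]; push_cast; ring
    · have := hK 0
      rw [hφ]; push_cast
      convert this using 2; ring
  | succ N ih =>
    obtain ⟨φ, h1, h2, h3, h4⟩ := ih (Fin.tail y) (Fin.tail A)
      (fun i j hij => hy (Fin.succ_lt_succ_iff.2 hij))
      (fun i j hij => hA (Fin.succ_lt_succ_iff.2 hij))
      (fun i j hij => hdvd _ _ (Fin.succ_lt_succ_iff.2 hij))
    obtain ⟨g, hg⟩ := hdvd 0 1 Fin.zero_lt_one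
    have hy01 : 0 < y 1 - y 0 := sub_pos.2 (hy Fin.zero_lt_one)
    have hA01 : 0 < A 1 - A 0 := sub_pos.2 (hA Fin.zero_lt_one)
    have hg0 : 0 < g := by
      rw [hg] at hA01; exact pos_of_mul_pos_right hA01 hy01.le
    have hg' : (A 1 : ℝ) - A 0 = (y 1 - y 0) * g := by exact_mod_cast hg
    obtain ⟨ψ, h5, h6⟩ := exists_orderIso_bend φ (δ * y 1) (s := g) (by exact_mod_cast hg0)
    have h21 : φ (δ * y 1) = δ * A 1 := h2 0
    rw [h21] at h6
    have hyR : ∀ i j, i ≤ j → δ * (y i : ℝ) ≤ δ * y j := fun i j hij =>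
      mul_le_mul_of_nonneg_left (by exact_mod_cast hy.monotone hij) hδ.le
    have h60 : ψ (δ * y 0) = δ * A 0 := by
      rw [h6 _ (hyR _ _ (Fin.zero_le _))]
      linear_combination δ * hg'
    refine ⟨ψ, fun m => ?_, fun i => ?_, fun t ht => ?_, fun K hK t ht => ?_⟩
    · rcases le_total (δ * (y 1 : ℝ)) (δ * m) with h | h
      · rw [h5 _ h]; exact h1 m
      · exact ⟨A 1 + g * (m - y 1), by rw [h6 _ h]; push_cast; ring⟩
    · cases i using Fin.cases with
      | zero => exact h60
      | succ i =>
        rw [h5 _ (hyR 1 i.succ (by simp [Fin.le_def]))]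
        exact h2 i
    · rw [h5 t ((hyR 1 (Fin.last _) (Fin.le_last _)).trans ht)]
      exact h3 t ht
    · rcases le_total (δ * (y 1 : ℝ)) t with h | h
      · rw [h5 _ h]
        exact h4 K (fun i => hK i.succ) t h
      · have e0 := abs_le.1 (hK 0)
        have e1 := abs_le.1 (hK 1)
        have e2 : (δ * (A 1 : ℝ)) - δ * A 0 = (δ * y 1 - δ * y 0) * g := by
          linear_combination δ * hg'
        have ht' : δ * (y 0 : ℝ) ≤ t := ht
        rw [h6 _ h, abs_le]
        rcases le_total (g : ℝ) σ with hc | hc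
        · constructor <;>
            nlinarith [mul_nonneg (sub_nonneg.2 hc) (sub_nonneg.2 h),
              mul_nonneg (sub_nonneg.2 hc) (sub_nonneg.2 ht')]
        · constructor <;>
            nlinarith [mul_nonneg (sub_nonneg.2 hc) (sub_nonneg.2 h),
              mul_nonneg (sub_nonneg.2 hc) (sub_nonneg.2 ht')]

lemma exists_orderIso_interpolate' {n : ℕ} [NeZero n] {δ : ℝ} (hδ : 0 < δ) {y A : Fin n → ℤ}
    (hy : StrictMono y) (hA : StrictMono A) (hdvd : ∀ i j, i < j → y j - y i ∣ A j - A i)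
    {σ : ℕ} (hσ : 0 < σ) :
    ∃ φ : ℝ ≃o ℝ, (∀ m : ℤ, ∃ m' : ℤ, φ (δ * m) = δ * m') ∧ (∀ i, φ (δ * y i) = δ * A i) ∧
      (∃ (C : ℝ) (c : ℤ), ∀ t ≥ C, φ t = σ * t + δ * c) ∧
      ∀ K : ℝ, (∀ i, |δ * A i - σ * (δ * y i)| ≤ K) → ∀ t ≥ δ * y 0, |φ t - σ * t| ≤ K := by
  obtain ⟨N, rfl⟩ := Nat.exists_eq_succ_of_ne_zero (NeZero.ne n)
  obtain ⟨φ, h1, h2, h3, h4⟩ := exists_orderIso_interpolate δ N y A hy hA hdvd hσ hδ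
  exact ⟨φ, h1, h2, ⟨_, _, h3⟩, h4⟩

/-- A proper global system passing infinitely often, in the direction `e₁`, through lattice points
whose directions approach that of `x`. -/
structure IsRecurrentSys {n : ℕ} [NeZero n] (δ : ℝ) (x : RVec n) (P : ℝ → RVec n) : Prop where
  sys : IsGlobalSys δ P
  proper : ∀ M : ℝ, ∃ t, ∀ i, M ≤ P t i
  recurrent : ∀ N : ℝ, ∀ ε > 0, ∃ r ≥ N, RightSlope P r 0 ∧ IsLatticePt δ (P r) ∧
    ∀ i, |P r i - r * x i| ≤ ε * r

lemma abs_normalized_sub_le {n : ℕ} {v w : RVec n} {q t σ K : ℝ} (hv : ∀ i, 0 ≤ v i)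
    (hvq : ∑ i, v i = q) (hwt : ∑ i, w i = t) (hσ : 0 < σ) (ht : 0 < t) (hq : 0 < q)
    (hK : ∀ i, |v i - σ * w i| ≤ K) (i : Fin n) :
    |q⁻¹ * v i - t⁻¹ * w i| ≤ (n + 1) * K / (σ * t) := by
  have h1 : |σ * t - q| ≤ n * K := by
    rw [← hvq, ← hwt, Finset.mul_sum, ← Finset.sum_sub_distrib]
    refine (Finset.abs_sum_le_sum_abs _ _).trans ?_
    refine (Finset.sum_le_card_nsmul _ _ K fun i _ => ?_).trans (by simp)
    rw [abs_sub_comm]; exact hK i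
  have h2 : q⁻¹ * v i ≤ 1 := by
    rw [inv_mul_le_one₀ hq, ← hvq]
    exact Finset.single_le_sum (fun i _ => hv i) (Finset.mem_univ i)
  have h3 : 0 ≤ q⁻¹ * v i := mul_nonneg (inv_nonneg.2 hq.le) (hv i)
  have h4 : q⁻¹ * v i - t⁻¹ * w i
      = (q⁻¹ * v i * (σ * t - q) + (v i - σ * w i)) / (σ * t) := by
    field_simp; ring
  rw [h4, abs_div, abs_of_pos (mul_pos hσ ht)]
  refine div_le_div_of_nonneg_right ?_ (mul_pos hσ ht).le
  refine (abs_add_le _ _).trans ?_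
  rw [abs_mul, abs_of_nonneg h3]
  have := mul_le_mul h2 h1 (abs_nonneg _) zero_le_one
  linarith [hK i]

/-- Positive integral multiples `σ'` of `L` such that `σ' r` is close to a large number `V`. -/
lemma exists_multiple {L : ℕ} (hL : 0 < L) {r V : ℝ} (hr : 0 < r) (hV : L * r ≤ V) :
    ∃ σ' : ℕ, 0 < σ' ∧ L ∣ σ' ∧ σ' * r ≤ V ∧ V ≤ σ' * r + L * r := by
  have hLr : 0 < L * r := mul_pos (Nat.cast_pos.2 hL) hr
  have h0 : 0 ≤ V / (L * r) := div_nonneg (hLr.le.trans hV) hLr.le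
  refine ⟨L * ⌊V / (L * r)⌋₊, Nat.mul_pos hL (Nat.floor_pos.2 ?_), dvd_mul_right _ _, ?_, ?_⟩
  · rwa [one_le_div hLr]
  · have := (le_div_iff₀ hLr).1 (Nat.floor_le h0)
    push_cast; linarith
  · have := (div_lt_iff₀ hLr).1 (Nat.lt_floor_add_one (V / (L * r)))
    push_cast; linarith

/-- Switching from a dilate of `P` to a deformed dilate of `P'`. -/
lemma exists_switch {n : ℕ} [NeZero n] {δ : ℝ} (hδ : 0 < δ) {x : RVec n} {P P' S : ℝ → RVec n}
    (hP : IsRecurrentSys δ x P) (hP' : IsRecurrentSys δ x P') (hS : IsGlobalSys δ S)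
    {σ : ℕ} (hσ : 0 < σ) {c : ℤ}
    (hSP : ∃ t₀, ∀ t ≥ t₀, ∀ i, S (σ * t + n * (δ * c)) i = σ * P t i + δ * c)
    {r ε : ℝ} (hr : 0 < r) (hε : 0 < ε) (hr0 : RightSlope P' r 0) (hrl : StrictMono (P' r))
    (hrx : ∀ i, |P' r i - r * x i| ≤ ε * r) {Y : Fin n → ℤ} (hY : ∀ i, P' r i = δ * Y i)
    (hdvd : ∀ i j, i < j → Y j - Y i ∣ σ) {L : ℕ} (hL : 0 < L) {N : ℝ} (hN : 0 < N) :
    ∃ e ≥ N, ∃ (S' : ℝ → RVec n) (σ' : ℕ) (c' : ℤ), IsGlobalSys δ S' ∧ 0 < σ' ∧ L ∣ σ' ∧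
      (∃ t₀, ∀ t ≥ t₀, ∀ i, S' (σ' * t + n * (δ * c')) i = σ' * P' t i + δ * c') ∧
      (∀ q ≤ e, S' q = S q) ∧ (∀ i, N ≤ S e i) ∧
      ∃ τ : ℝ ≃o ℝ, τ r = e ∧ ∀ t ≥ r, ∀ i,
        |(τ t)⁻¹ * S' (τ t) i - t⁻¹ * P' t i| ≤ 3 * (n + 1) * ε := by
  have hσR : (0 : ℝ) < σ := Nat.cast_pos.2 hσ
  obtain ⟨t₀, ht₀⟩ := hSP
  obtain ⟨t₁, ht₁⟩ := hP.proper ((N - δ * c) / σ)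
  set V₀ := (|δ * c| + (‖x‖ + ε) * (L * r)) / ε + L * r with hV₀
  obtain ⟨u, hu, hu0, ⟨hu1, hu2⟩, hux⟩ := hP.recurrent
    (max (max t₀ t₁) (max (V₀ / σ) ((N - n * (δ * c)) / σ))) ε hε
  simp only [ge_iff_le, max_le_iff] at hu
  obtain ⟨⟨hut₀, hut₁⟩, huV, huN⟩ := hu
  rw [div_le_iff₀ hσR] at huV huN
  choose p hp using hu2
  set e := σ * u + n * (δ * c) with he
  have hSe : ∀ i, S e i = σ * P u i + δ * c := ht₀ u hut₀
  have hSeN : ∀ i, N ≤ S e i := by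
    intro i
    have := (ht₁ i).trans (hP.sys.coord_mono i hut₁)
    rw [div_le_iff₀ hσR] at this
    rw [hSe]; simp only at this; linarith
  have hLr : 0 < L * r := mul_pos (Nat.cast_pos.2 hL) hr
  have hV₀' : L * r ≤ V₀ := by
    have : 0 ≤ (|δ * c| + (‖x‖ + ε) * (L * r)) / ε := by positivity
    rw [hV₀]
    linarith
  obtain ⟨σ', hσ', hLσ', hσ'1, hσ'2⟩ := exists_multiple hL hr (V := σ * u) (by linarith)
  have hσ'R : (0 : ℝ) < σ' := Nat.cast_pos.2 hσ'
  let A : Fin n → ℤ := fun i => σ * p i + c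
  have hSA : ∀ i, S e i = δ * A i := by
    intro i; rw [hSe, hp]; push_cast [A]; ring
  have hpm : StrictMono p := by
    intro i j hij
    have := hu1 hij
    rw [hp, hp, mul_lt_mul_iff_right₀ hδ] at this
    exact_mod_cast this
  have hAm : StrictMono A := by
    intro i j hij
    have : (σ : ℤ) * p i < σ * p j := mul_lt_mul_of_pos_left (hpm hij) (by exact_mod_cast hσ)
    simp only [A]; linarith
  have hYm : StrictMono Y := by
    intro i j hij
    have := hrl hij
    rw [hY, hY, mul_lt_mul_iff_right₀ hδ] at this
    exact_mod_cast this
  have hAY : ∀ i j, i < j → Y j - Y i ∣ A j - A i := by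
    intro i j hij
    have : A j - A i = σ * (p j - p i) := by simp only [A]; ring
    rw [this]
    exact (hdvd i j hij).mul_right _
  obtain ⟨φ, hφ1, hφ2, ⟨C, c', hφ3⟩, hφ4⟩ := exists_orderIso_interpolate' hδ hYm hAm hAY hσ'
  have hclose : ∀ i, |δ * A i - σ' * (δ * Y i)| ≤ 3 * ε * (σ' * r) := by
    intro i
    rw [← hSA, ← hY, hSe]
    have h1 : σ * P u i + δ * c - σ' * P' r i = σ * (P u i - u * x i) + δ * c
        + (σ * u - σ' * r) * x i - σ' * (P' r i - r * x i) := by ring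
    have h2 : |σ * (P u i - u * x i)| ≤ ε * (σ * u) := by
      rw [abs_mul, abs_of_pos hσR]
      have := mul_le_mul_of_nonneg_left (hux i) hσR.le
      linarith
    have h3 : |σ' * (P' r i - r * x i)| ≤ ε * (σ' * r) := by
      rw [abs_mul, abs_of_pos hσ'R]
      have := mul_le_mul_of_nonneg_left (hrx i) hσ'R.le
      linarith
    have h4 : |(σ * u - σ' * r) * x i| ≤ L * r * ‖x‖ := by
      rw [abs_mul, abs_of_nonneg (by linarith)]
      exact mul_le_mul (by linarith) (norm_le_pi_norm x i) (abs_nonneg _) hLr.le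
    have h5 : |δ * c| + (‖x‖ + ε) * (L * r) ≤ ε * (σ' * r) := by
      have : (|δ * c| + (‖x‖ + ε) * (L * r)) / ε ≤ σ' * r := by linarith
      rw [div_le_iff₀ hε] at this
      linarith
    have h6 := mul_le_mul_of_nonneg_left hσ'2 hε.le
    rw [h1]
    have h7 := abs_sub (σ * (P u i - u * x i) + δ * c + (σ * u - σ' * r) * x i)
      (σ' * (P' r i - r * x i))
    have h8 := abs_add_three (σ * (P u i - u * x i)) (δ * c) ((σ * u - σ' * r) * x i)
    linarith
  set T := glue (lineFrom r (P' r)) P' r with hT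
  have hTP : ∀ t ≥ r, T t = P' t := fun t ht => glue_of_ge (lineFrom_self _ _) ht
  have hTs : IsGlobalSys δ T := isGlobalSys_glue_lineFrom (fun t _ => hP'.sys.sum_eq t)
    (fun t _ => hP'.sys.mono t) (fun t _ => hP'.sys.locallyRigid t) hr0 ⟨hrl, fun i => ⟨_, hY i⟩⟩
  obtain ⟨τ, hτ⟩ := hTs.exists_sum_orderIso φ
  have hτr : τ r = e := by
    rw [hτ, ← hS.sum_eq e]
    exact Finset.sum_congr rfl fun i _ => by rw [hTP r le_rfl, hY, hφ2, hSA]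
  set U : ℝ → RVec n := fun q i => φ (T (τ.symm q) i) with hU
  have hUs : IsGlobalSys δ U := hTs.map hτ hφ1
  have hUτ : ∀ t ≥ r, ∀ i, U (τ t) i = φ (P' t i) := by
    intro t ht i
    simp only [hU, τ.symm_apply_apply, hTP t ht]
  have hSU : S e = U e := by
    ext i
    rw [← hτr, hUτ r le_rfl, hτr, hY, hφ2, hSA]
  have hU0 : RightSlope U e 0 := by
    refine IsGlobalSys.rightSlope_map hτ ?_
    rw [← hτr, τ.symm_apply_apply]
    refine hr0.congr ?_
    filter_upwards [self_mem_nhdsWithin] with t ht using hTP t ht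
  have hgS : ∀ t ≥ r, ∀ i, glue S U e (τ t) i = φ (P' t i) := by
    intro t ht i
    rw [glue_of_ge hSU (by rw [← hτr]; exact τ.monotone ht), hUτ t ht]
  have hG : IsGlobalSys δ (glue S U e) :=
    isGlobalSys_glue hSU (fun t _ => hS.sum_eq t) (fun t _ => hUs.sum_eq t)
      (fun t _ => hS.mono t) (fun t _ => hUs.mono t) (fun t _ => hS.locallyRigid t)
      (fun t _ => hUs.locallyRigid t) (hS.exists_leftSlope e) hU0
      ⟨fun i j hij => by
        rw [hSA, hSA]
        exact mul_lt_mul_of_pos_left (by exact_mod_cast hAm hij) hδ, fun i => ⟨_, hSA i⟩⟩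
  have heN : N ≤ e := by linarith
  refine ⟨e, heN, glue S U e, σ', c', hG, hσ', hLσ', ?_, fun q hq => glue_of_le hq, hSeN, τ, hτr,
    ?_⟩
  · obtain ⟨t₂, ht₂⟩ := hP'.proper C
    refine ⟨max r t₂, fun t ht i => ?_⟩
    have ht1 : r ≤ t := (le_max_left _ _).trans ht
    have hC : ∀ i, C ≤ P' t i := fun i =>
      (ht₂ i).trans (hP'.sys.coord_mono i ((le_max_right _ _).trans ht))
    have hτt : τ t = σ' * t + n * (δ * c') := by
      rw [hτ, hTP t ht1, Finset.sum_congr rfl fun i _ => hφ3 _ (hC i), Finset.sum_add_distrib,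
        ← Finset.mul_sum, hP'.sys.sum_eq]
      simp
    rw [← hτt, hgS t ht1, hφ3 _ (hC i)]
  · intro t ht i
    have htr : r ≤ t := ht
    have ht0 : 0 < t := hr.trans_le ht
    have hq : e ≤ τ t := hτr ▸ τ.monotone ht
    have hb := abs_normalized_sub_le (v := glue S U e (τ t)) (w := P' t) (q := τ t) (t := t)
      (σ := σ') (K := 3 * ε * (σ' * r))
      (fun i => by
        have := hG.coord_mono i hq
        simp only [glue_of_le (le_refl e)] at this
        exact hN.le.trans ((hSeN i).trans this))
      (hG.sum_eq _) (hP'.sys.sum_eq t) hσ'R ht0 (by linarith)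
      (fun i => by
        rw [hgS t ht]
        refine hφ4 _ hclose _ ?_
        rw [← hY]
        exact (hP'.sys.coord_mono 0 htr).trans (hP'.sys.mono t (Fin.zero_le i))) i
    refine hb.trans ?_
    rw [div_le_iff₀ (mul_pos hσ'R ht0)]
    have : ε * (n + 1) * σ' * r ≤ ε * (n + 1) * σ' * t :=
      mul_le_mul_of_nonneg_left htr (by positivity)
    linarith

/-- A sequence of systems, each of which agrees with the previous one on longer and longer
intervals, has a limit. -/
lemma exists_limit_sys {n : ℕ} {δ : ℝ} {S : ℕ → ℝ → RVec n} {e : ℕ → ℝ} (he : Monotone e)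
    (he' : ∀ q, ∃ j, q < e j) (hS : ∀ j, ∀ q ≤ e j, S (j + 1) q = S j q)
    (hsys : ∀ j, IsGlobalSys δ (S j)) :
    ∃ R : ℝ → RVec n, IsGlobalSys δ R ∧ ∀ j, ∀ q ≤ e j, R q = S j q := by
  have hcons : ∀ i j, i ≤ j → ∀ q ≤ e i, S j q = S i q := by
    intro i j hij
    induction j, hij using Nat.le_induction with
    | base => intro q _; rfl
    | succ j hij ih => exact fun q hq => (hS j q (hq.trans (he hij))).trans (ih q hq)
  choose J hJ using he'
  have hR : ∀ j, ∀ q ≤ e j, S (J q) q = S j q := by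
    intro j q hq
    rcases le_total j (J q) with h | h
    · exact hcons _ _ h q hq
    · exact (hcons _ _ h q (hJ q).le).symm
  refine ⟨fun q => S (J q) q, ⟨fun q => (hsys (J q)).sum_eq q, fun q => (hsys (J q)).mono q,
    fun q => ((hsys (J q)).locallyRigid q).congr ?_⟩, hR⟩
  filter_upwards [Iio_mem_nhds (hJ q)] with s hs using hR (J q) s (le_of_lt hs)

lemma exists_common_multiple {n : ℕ} [NeZero n] (Y : Fin n → ℤ) (hY : StrictMono Y) :
    ∃ L : ℕ, 0 < L ∧ ∀ i j, i < j → Y j - Y i ∣ (L : ℤ) := by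
  refine ⟨(∏ i, ∏ j, if i < j then Y j - Y i else 1).natAbs, ?_, fun i j hij => ?_⟩
  · refine Int.natAbs_pos.2 (Finset.prod_ne_zero_iff.2 fun i _ =>
      Finset.prod_ne_zero_iff.2 fun j _ => ?_)
    split_ifs with h
    · exact (sub_pos.2 (hY h)).ne'
    · exact one_ne_zero
  · rw [Int.dvd_natAbs]
    refine dvd_trans ?_ (Finset.dvd_prod_of_mem _ (Finset.mem_univ i))
    refine dvd_trans ?_ (Finset.dvd_prod_of_mem _ (Finset.mem_univ j))
    rw [if_pos hij]

/-- Dilation of a system by a positive integer. -/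
lemma exists_dilate {n : ℕ} [NeZero n] {δ : ℝ} {P : ℝ → RVec n} (hP : IsGlobalSys δ P)
    {σ : ℕ} (hσ : 0 < σ) :
    ∃ S : ℝ → RVec n, IsGlobalSys δ S ∧ ∀ t i, S (σ * t) i = σ * P t i := by
  obtain ⟨τ, hτ⟩ := hP.exists_sum_orderIso (OrderIso.mulLeft₀ (σ : ℝ) (Nat.cast_pos.2 hσ))
  have hτ' : ∀ t, τ t = σ * t := by
    intro t
    rw [hτ]
    simp only [OrderIso.mulLeft₀_apply]
    rw [← Finset.mul_sum, hP.sum_eq]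
  refine ⟨_, hP.map hτ fun m => ⟨σ * m, ?_⟩, fun t i => ?_⟩
  · simp only [OrderIso.mulLeft₀_apply]; push_cast; ring
  · rw [← hτ', τ.symm_apply_apply]; rfl

/-- A stage of the construction of a system alternating between several given ones: a system `path`
eventually equal to a translated dilate (with parameters `scale` and `shift`) of one of them,
following it from `start`, and not to be modified before `bound`. -/
structure Stage (n : ℕ) where
  path : ℝ → RVec n
  scale : ℕ
  shift : ℤ
  start : ℝ
  bound : ℝ

/-- The requirements on a stage, which eventually follows `P`, and whose scale is a multiple
of `L`. -/
structure Stage.IsValid {n : ℕ} (s : Stage n) (δ : ℝ) (P : ℝ → RVec n) (L : ℕ) : Prop where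
  sys : IsGlobalSys δ s.path
  scale_pos : 0 < s.scale
  dvd_scale : L ∣ s.scale
  bound_pos : 0 < s.bound
  eventually_eq : ∃ t₀, ∀ t ≥ t₀, ∀ i,
    s.path (s.scale * t + n * (δ * s.shift)) i = s.scale * P t i + δ * s.shift

/-- The stage `s'` continues the stage `s`, its directions after `s'.start` being `ε`-close to
those of `P` after `r`. -/
structure Stage.IsNext {n : ℕ} (s s' : Stage n) (P : ℝ → RVec n) (r r' ε M : ℝ) : Prop where
  bound_le_start : s.bound ≤ s'.start
  start_le_bound : s'.start ≤ s'.bound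
  le_bound : M ≤ s'.bound
  path_eq : ∀ q ≤ s'.start, s'.path q = s.path q
  le_path : ∀ i, s.bound ≤ s.path s'.start i
  exists_of_path : ∀ q ≥ s'.start, ∃ t ≥ r, ∀ i, |q⁻¹ * s'.path q i - t⁻¹ * P t i| ≤ ε
  exists_path : ∀ t ≥ r, t ≤ r' →
    ∃ q ≥ s'.start, q ≤ s'.bound ∧ ∀ i, |q⁻¹ * s'.path q i - t⁻¹ * P t i| ≤ ε

lemma Stage.IsValid.exists_next {n : ℕ} [NeZero n] {δ : ℝ} (hδ : 0 < δ) {x : RVec n}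
    {P P' : ℝ → RVec n} (hP : IsRecurrentSys δ x P) (hP' : IsRecurrentSys δ x P') {s : Stage n}
    {L : ℕ} (hs : s.IsValid δ P L) {r ε : ℝ} (hr : 0 < r) (hε : 0 < ε) (hr0 : RightSlope P' r 0)
    (hrl : StrictMono (P' r)) (hrx : ∀ i, |P' r i - r * x i| ≤ ε * r) {Y : Fin n → ℤ}
    (hY : ∀ i, P' r i = δ * Y i) (hdvd : ∀ i j, i < j → Y j - Y i ∣ (L : ℤ)) {L' : ℕ}
    (hL' : 0 < L') (r' M : ℝ) :
    ∃ s' : Stage n, s'.IsValid δ P' L' ∧ s.IsNext s' P' r r' (3 * (n + 1) * ε) M := by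
  obtain ⟨e, he, S, σ, c, h1, h2, h3, h4, h5, h6, τ, h7, h8⟩ := exists_switch hδ hP hP' hs.sys
    hs.scale_pos hs.eventually_eq hr hε hr0 hrl hrx hY
    (fun i j hij => (hdvd i j hij).trans (Int.natCast_dvd_natCast.2 hs.dvd_scale)) hL' hs.bound_pos
  refine ⟨⟨S, σ, c, e, max (max e M) (τ r')⟩, ⟨h1, h2, h3, ?_, h4⟩, ⟨he, ?_, ?_, h5, h6, ?_, ?_⟩⟩
  · exact lt_max_of_lt_left (lt_max_of_lt_left (hs.bound_pos.trans_le he))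
  · exact le_max_of_le_left (le_max_left _ _)
  · exact le_max_of_le_left (le_max_right _ _)
  · intro q hq
    have hrq : r ≤ τ.symm q := by rw [τ.le_symm_apply, h7]; exact hq
    refine ⟨τ.symm q, hrq, fun i => ?_⟩
    have := h8 _ hrq i
    rwa [τ.apply_symm_apply] at this
  · intro t ht htr
    exact ⟨τ t, h7 ▸ τ.monotone ht, le_max_of_le_right (τ.monotone htr), h8 t ht⟩

lemma exists_consecutive {f : ℕ → ℝ} {q : ℝ} (h0 : f 0 ≤ q) (h : ∃ j, q < f j) :
    ∃ j, f j ≤ q ∧ q < f (j + 1) := by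
  by_contra! hcon
  obtain ⟨j, hj⟩ := h
  exact absurd hj (not_lt.2 (Nat.rec h0 hcon j))

/-- Alternating between the members of a `2`-periodic sequence of recurrent systems. -/
theorem exists_alternating_sys {n : ℕ} [NeZero n] {δ : ℝ} (hδ : 0 < δ) {x : RVec n}
    {P : ℕ → ℝ → RVec n} (hP : ∀ k, IsRecurrentSys δ x (P k)) (hper : ∀ k, P (k + 2) = P k) :
    ∃ a > 0, ∃ R : ℝ → RVec n, IsGlobalSys δ R ∧ IsLatticePt δ (R a) ∧ (∀ i, 0 < R a i) ∧
      (∀ M : ℝ, ∃ q, ∀ i, M ≤ R q i) ∧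
      (∀ N : ℝ, ∀ ε > 0, ∃ Q, ∀ q ≥ Q, ∃ k, ∃ t ≥ N, ∀ i,
        |q⁻¹ * R q i - t⁻¹ * P k t i| ≤ ε) ∧
      ∀ k, ∀ N : ℝ, ∀ ε > 0, ∃ T, ∀ t ≥ T, ∃ q ≥ N, ∀ i,
        |q⁻¹ * R q i - t⁻¹ * P k t i| ≤ ε := by
  have hε : ∀ k : ℕ, (0 : ℝ) < 1 / (k + 1) := fun k => Nat.one_div_pos_of_nat
  choose r hrk hr0 hrl hrx using fun k : ℕ => (hP k).recurrent (k + 1) _ (hε k)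
  have hrpos : ∀ k, 0 < r k := fun k => lt_of_lt_of_le (by positivity) (hrk k)
  choose Y hY using fun k => (hrl k).2
  have hYm : ∀ k, StrictMono (Y k) := by
    intro k i j hij
    have := (hrl k).1 hij
    rw [hY, hY, mul_lt_mul_iff_right₀ hδ] at this
    exact_mod_cast this
  choose L hL hdvd using fun k => exists_common_multiple (Y k) (hYm k)
  -- the initial stage
  obtain ⟨S₀, hS₀, hS₀P⟩ := exists_dilate (hP 0).sys (hL 1)
  obtain ⟨t₁, ht₁⟩ := (hP 0).proper 1
  obtain ⟨r₀, hr₀, -, hr₀l, -⟩ := (hP 0).recurrent (max 1 t₁) 1 one_pos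
  have hL1 : (0 : ℝ) < L 1 := Nat.cast_pos.2 (hL 1)
  have ha : 0 < L 1 * r₀ := mul_pos hL1 (by linarith [le_max_left 1 t₁])
  let s₀ : {s : Stage n // s.IsValid δ (P 0) (L 1)} := ⟨⟨S₀, L 1, 0, 0, L 1 * r₀⟩,
    ⟨hS₀, hL 1, dvd_rfl, ha, 0, fun t _ i => by simpa using hS₀P t i⟩⟩
  have hstep : ∀ (k : ℕ) (s : {s : Stage n // s.IsValid δ (P k) (L (k + 1))}),
      ∃ s' : {s : Stage n // s.IsValid δ (P (k + 1)) (L (k + 1 + 1))},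
        s.1.IsNext s'.1 (P (k + 1)) (r (k + 1)) (r (k + 3))
          (3 * (n + 1) * (1 / ((k + 1 : ℕ) + 1))) k := by
    rintro k ⟨s, hs⟩
    obtain ⟨s', h1, h2⟩ := hs.exists_next hδ (hP k) (hP (k + 1)) (hrpos _) (hε (k + 1)) (hr0 _)
      (hrl _).1 (hrx _) (hY _) (hdvd _) (hL (k + 1 + 1)) (r (k + 3)) k
    exact ⟨⟨s', h1⟩, h2⟩
  choose next hnext using hstep
  let st : ∀ k : ℕ, {s : Stage n // s.IsValid δ (P k) (L (k + 1))} := fun k => Nat.rec s₀ next k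
  have hst : ∀ k, (st k).1.IsNext (st (k + 1)).1 (P (k + 1)) (r (k + 1)) (r (k + 3))
      (3 * (n + 1) * (1 / ((k + 1 : ℕ) + 1))) k := fun k => hnext k (st k)
  set e : ℕ → ℝ := fun k => (st (k + 1)).1.start with he
  have hemono : Monotone e := monotone_nat_of_le_succ fun k =>
    (hst k).start_le_bound.trans (hst (k + 1)).bound_le_start
  have hek : ∀ k : ℕ, (k : ℝ) ≤ e (k + 1) := fun k =>
    (hst k).le_bound.trans (hst (k + 1)).bound_le_start
  have hetop : ∀ q, ∃ j, q < e j := fun q => by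
    obtain ⟨k, hk⟩ := exists_nat_gt q
    exact ⟨k + 1, hk.trans_le (hek k)⟩
  obtain ⟨R, hR, hRS⟩ := exists_limit_sys hemono hetop (S := fun k => (st k).1.path)
    (fun j q hq => (hst j).path_eq q hq) fun j => (st j).2.sys
  have hεsmall : ∀ ε > (0 : ℝ), ∃ K : ℕ, ∀ k ≥ K, 3 * (n + 1) * (1 / ((k : ℝ) + 1)) ≤ ε := by
    intro ε hε
    obtain ⟨K, hK⟩ := exists_nat_gt (3 * (n + 1) / ε)
    refine ⟨K, fun k hk => ?_⟩
    have hkK : (K : ℝ) ≤ k := Nat.cast_le.2 hk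
    rw [mul_one_div, div_le_iff₀ (by positivity)]
    rw [div_lt_iff₀ hε] at hK
    nlinarith
  have hRa : ∀ i, R (L 1 * r₀) i = L 1 * P 0 r₀ i := by
    intro i
    have h0 : (L 1 : ℝ) * r₀ ≤ e 0 := (hst 0).bound_le_start
    rw [hRS 0 _ h0]
    exact hS₀P r₀ i
  refine ⟨L 1 * r₀, ha, R, hR, ⟨fun i j hij => ?_, fun i => ?_⟩, fun i => ?_, fun M => ?_,
    fun N ε hε => ?_, fun k N ε hε => ?_⟩
  · rw [hRa, hRa]
    exact mul_lt_mul_of_pos_left (hr₀l.1 hij) hL1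
  · obtain ⟨m, hm⟩ := hr₀l.2 i
    exact ⟨L 1 * m, by rw [hRa, hm]; push_cast; ring⟩
  · rw [hRa]
    refine mul_pos hL1 (lt_of_lt_of_le one_pos ((ht₁ i).trans ?_))
    exact (hP 0).sys.coord_mono i ((le_max_right _ _).trans hr₀)
  · obtain ⟨k, hk⟩ := exists_nat_ge M
    refine ⟨e (k + 1), fun i => ?_⟩
    rw [hRS (k + 1) _ le_rfl]
    exact hk.trans ((hst k).le_bound.trans ((hst (k + 1)).le_path i))
  · obtain ⟨K₁, hK₁⟩ := hεsmall ε hε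
    obtain ⟨K₂, hK₂⟩ := exists_nat_ge N
    refine ⟨e (max K₁ K₂), fun q hq => ?_⟩
    obtain ⟨j, hj₁, hj₂⟩ := exists_consecutive (f := fun j => e (max K₁ K₂ + j)) hq <| by
      obtain ⟨j, hj⟩ := hetop q
      exact ⟨j, hj.trans_le (hemono (Nat.le_add_left _ _))⟩
    set k := max K₁ K₂ + j with hk
    obtain ⟨t, ht, hclose⟩ := (hst k).exists_of_path q hj₁
    refine ⟨k + 1, t, ?_, fun i => ?_⟩
    · have h1 := hrk (k + 1)
      have h2 : (K₂ : ℝ) ≤ k := Nat.cast_le.2 (by omega)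
      push_cast at h1
      linarith
    · have hq' : q ≤ e (k + 1) := hj₂.le
      rw [hRS (k + 1) q hq']
      exact (hclose i).trans (hK₁ (k + 1) (by omega))
  · obtain ⟨K₁, hK₁⟩ := hεsmall ε hε
    obtain ⟨K₂, hK₂⟩ := exists_nat_ge N
    have hper' : ∀ j, P (k + 2 * j) = P k := by
      intro j
      induction j with
      | zero => rfl
      | succ j ih => rw [← ih, ← hper (k + 2 * j)]; rfl
    set K := k + 2 * (K₁ + K₂ + 1) with hK
    refine ⟨r K, fun t ht => ?_⟩
    have hex : ∃ j : ℕ, t < r (K + 2 * j) := by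
      obtain ⟨j, hj⟩ := exists_nat_gt t
      refine ⟨j, hj.trans_le (le_trans ?_ (hrk _))⟩
      push_cast
      have : (0 : ℝ) ≤ (K : ℝ) := Nat.cast_nonneg _
      have : (0 : ℝ) ≤ (j : ℝ) := Nat.cast_nonneg _
      linarith
    obtain ⟨j, hj₁, hj₂⟩ := exists_consecutive (f := fun j => r (K + 2 * j)) ht hex
    obtain ⟨m, hm⟩ : ∃ m, K + 2 * j = m + 1 := ⟨K + 2 * j - 1, by omega⟩
    have hm' : K + 2 * (j + 1) = m + 3 := by omega
    rw [hm] at hj₁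
    rw [hm'] at hj₂
    obtain ⟨q, hq₁, hq₂, hclose⟩ := (hst m).exists_path t hj₁ hj₂.le
    refine ⟨q, ?_, fun i => ?_⟩
    · obtain ⟨m', rfl⟩ : ∃ m', m = m' + 1 := ⟨m - 1, by omega⟩
      have h2 : (K₂ : ℝ) ≤ m' := Nat.cast_le.2 (by omega)
      exact hK₂.trans (h2.trans ((hek m').trans hq₁))
    · have hq' : q ≤ e (m + 1) := hq₂.trans (hst (m + 1)).bound_le_start
      have hPk : P (m + 1) = P k := by
        rw [← hm, hK, add_assoc, ← mul_add]
        exact hper' _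
      rw [hRS (m + 1) q hq', ← hPk]
      exact (hclose i).trans (hK₁ (m + 1) (by omega))

/-- A proper rigid system on the half-line `[a, ∞)`, in terms of local slopes. -/
structure IsRaySys {n : ℕ} (δ a : ℝ) (P : ℝ → RVec n) : Prop where
  sum_eq : ∀ t ≥ a, ∑ i, P t i = t
  mono : ∀ t ≥ a, Monotone (P t)
  exists_rightSlope : ∀ t ≥ a, ∃ k, RightSlope P t k
  locallyRigid : ∀ t > a, LocallyRigidAt δ P t
  lattice : IsLatticePt δ (P a)
  proper : ∀ M : ℝ, ∃ t ≥ a, ∀ i, M ≤ P t i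

namespace IsRaySys

variable {n : ℕ} {δ a : ℝ} {P : ℝ → RVec n}

lemma exists_leftSlope (h : IsRaySys δ a P) (t : ℝ) (ht : a < t) : ∃ k, LeftSlope P t k :=
  let ⟨_, l, hl, _⟩ := h.locallyRigid t ht
  ⟨l, hl⟩

lemma coord_le (h : IsRaySys δ a P) {s t : ℝ} (has : a ≤ s) (hst : s ≤ t) (i : Fin n) :
    P s i ≤ P t i :=
  coord_le_of_slopes h.exists_rightSlope h.exists_leftSlope has hst i

lemma eq_line (h : IsRaySys δ a P) {s t : ℝ} {k : Fin n} (hs : a ≤ s) (ht : a ≤ t)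
    (hi : ∀ i ≠ k, P t i = P s i) : P t = P s + (t - s) • eVec n k := by
  have hsum : ∑ i, (P t i - P s i) = t - s := by
    rw [Finset.sum_sub_distrib, h.sum_eq t ht, h.sum_eq s hs]
  rw [Finset.sum_eq_single k (fun i _ hik => by rw [hi i hik, sub_self]) (by simp)] at hsum
  funext i
  rw [line_apply]
  by_cases hik : i = k
  · subst hik
    rw [eVec_self]; linarith
  · rw [eVec_of_ne hik, hi i hik]; simp

/-- Along a line of slope `e₁`, one finds lattice points. -/
lemma exists_lattice_near [NeZero n] (h : IsRaySys δ a P) (hδ : 0 < δ) {q : ℝ} (haq : a ≤ q)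
    (hq : RightSlope P q 0) :
    ∃ r, a ≤ r ∧ r ≤ q ∧ q ≤ r + δ ∧ RightSlope P r 0 ∧ IsLatticePt δ (P r) ∧
      P q = P r + (q - r) • eVec n 0 := by
  let A : Set ℝ := {t | t ∈ Icc a q ∧ ∀ i : Fin n, i ≠ 0 → P t i = P q i}
  have hcont := continuousOn_of_slopes h.exists_rightSlope h.exists_leftSlope
  have hA : IsCompact A := by
    refine IsCompact.of_isClosed_subset isCompact_Icc ?_ fun t ht => ht.1
    have : A = Icc a q ∩ ⋂ i : Fin n, ⋂ _ : i ≠ 0, (Icc a q ∩ (fun t => P t i) ⁻¹' {P q i}) := by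
      ext t
      simp only [A, mem_ofPred_eq, mem_inter_iff, mem_iInter, mem_preimage, mem_singleton_iff]
      exact ⟨fun ⟨h1, h2⟩ => ⟨h1, fun i hi => ⟨h1, h2 i hi⟩⟩,
        fun ⟨h1, h2⟩ => ⟨h1, fun i hi => (h2 i hi).2⟩⟩
    rw [this]
    refine isClosed_Icc.inter (isClosed_iInter fun i => isClosed_iInter fun _ => ?_)
    exact (((continuous_apply i).comp_continuousOn hcont).mono
      fun t ht => ht.1).preimage_isClosed_of_isClosed isClosed_Icc isClosed_singleton
  obtain ⟨s, ⟨⟨has, hsq⟩, hsA⟩, hsmin⟩ := hA.exists_isLeast ⟨q, ⟨haq, le_rfl⟩, fun _ _ => rfl⟩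
  have hflat : ∀ t, s ≤ t → t ≤ q → ∀ i : Fin n, i ≠ 0 → P t i = P q i := fun t hst htq i hi =>
    le_antisymm (h.coord_le (has.trans hst) htq i) (hsA i hi ▸ h.coord_le has hst i)
  have hright : ∀ t, s ≤ t → t ≤ q → RightSlope P t 0 := by
    intro t hst htq
    rcases eq_or_lt_of_le htq with rfl | hlt
    · exact hq
    · filter_upwards [Icc_mem_nhdsGE hlt] with u hu
      refine h.eq_line (has.trans hst) (has.trans (hst.trans hu.1)) fun i hi => ?_
      rw [hflat u (hst.trans hu.1) hu.2 i hi, hflat t hst htq i hi]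
  have hlat : IsLatticePt δ (P s) := by
    rcases eq_or_lt_of_le has with rfl | hlt
    · exact h.lattice
    obtain ⟨k, l, h1, h2, -, h4⟩ := h.locallyRigid s hlt
    obtain rfl := h2.unique (hright s le_rfl hsq)
    refine h4 (Fin.pos_iff_ne_zero.2 fun hl => ?_)
    subst hl
    have h1' : ∀ᶠ t in 𝓝[<] s, P t = P s + (t - s) • eVec n (0 : Fin n) :=
      h1.filter_mono (nhdsWithin_mono _ Iio_subset_Iic_self)
    obtain ⟨t, ht1, ht2⟩ := (h1'.and (Ico_mem_nhdsLT hlt)).exists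
    refine absurd (hsmin (a := t) ⟨⟨ht2.1, ht2.2.le.trans hsq⟩, fun i hi => ?_⟩) (not_le.2 ht2.2)
    rw [ht1, line_apply, eVec_of_ne hi, mul_zero, add_zero, hsA i hi]
  have hfl := Int.floor_le ((q - s) / δ)
  have hfl' := Int.lt_floor_add_one ((q - s) / δ)
  have hfl0 : (0 : ℝ) ≤ ⌊(q - s) / δ⌋ :=
    Int.cast_nonneg (Int.floor_nonneg.2 (div_nonneg (sub_nonneg.2 hsq) hδ.le))
  rw [le_div_iff₀ hδ] at hfl
  rw [div_lt_iff₀ hδ] at hfl'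
  set m := ⌊(q - s) / δ⌋
  have hsr : s ≤ s + m * δ := by linarith [mul_nonneg hfl0 hδ.le]
  have hrq : s + m * δ ≤ q := by linarith
  have hflat' := hflat _ hsr hrq
  have hPr := h.eq_line (k := 0) has (has.trans hsr)
    fun i hi => (hflat' i hi).trans (hsA i hi).symm
  have hlt : ∀ i : Fin n, i ≠ 0 → P q 0 < P q i := by
    intro i hi
    have hq' : ∀ᶠ t in 𝓝[>] q, P t = P q + (t - q) • eVec n (0 : Fin n) :=
      hq.filter_mono (nhdsWithin_mono _ Ioi_subset_Ici_self)
    obtain ⟨t, ht1, ht2⟩ := (hq'.and self_mem_nhdsWithin).exists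
    have ht2 : q < t := ht2
    have := h.mono t (haq.trans ht2.le) (Fin.zero_le i)
    rw [ht1, line_apply, line_apply, eVec_self, eVec_of_ne hi] at this
    linarith
  refine ⟨s + m * δ, has.trans hsr, hrq, by linarith, hright _ hsr hrq, ⟨fun i j hij => ?_,
    fun i => ?_⟩, h.eq_line (has.trans hsr) haq fun i hi => (hflat' i hi).symm⟩
  · have hj : j ≠ 0 := (lt_of_le_of_lt (Fin.zero_le i) hij).ne'
    by_cases hi : i = 0
    · subst hi
      rw [hflat' j hj]
      exact (h.coord_le (has.trans hsr) hrq 0).trans_lt (hlt j hj)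
    · rw [hflat' i hi, hflat' j hj, ← hsA i hi, ← hsA j hj]
      exact hlat.1 hij
  · obtain ⟨z, hz⟩ := hlat.2 i
    rw [hPr, line_apply, hz]
    by_cases hi : i = 0
    · subst hi
      exact ⟨z + m, by rw [eVec_self]; push_cast; ring⟩
    · exact ⟨z, by rw [eVec_of_ne hi]; ring⟩

/-- Extending a proper rigid system to the left by a line, one gets a recurrent system. -/
lemma exists_isRecurrentSys [NeZero n] (h : IsRaySys δ a P) (hδ : 0 < δ) {x : RVec n}
    (hx : ∀ N : ℝ, ∀ ε > 0, ∃ q ≥ N, RightSlope P q 0 ∧ ∀ i, |q⁻¹ * P q i - x i| ≤ ε) :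
    ∃ U : ℝ → RVec n, IsRecurrentSys δ x U ∧ ∃ b ≥ a, ∀ t ≥ b, U t = P t := by
  have hrec : ∀ N : ℝ, ∀ ε > 0, ∃ r ≥ N, RightSlope P r 0 ∧ IsLatticePt δ (P r) ∧
      ∀ i, |P r i - r * x i| ≤ ε * r := by
    intro N ε hε
    set B := ∑ i, |x i| with hB
    have hB0 : 0 ≤ B := Finset.sum_nonneg fun i _ => abs_nonneg _
    obtain ⟨q, hqN, hq0, hqx⟩ := hx (max (max a N) 0 + δ + 2 * δ * (1 + B + ε) / ε) (ε / 2)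
      (half_pos hε)
    have h0 : 0 ≤ 2 * δ * (1 + B + ε) / ε := by positivity
    have hm1 := le_max_left (max a N) 0
    have hm2 := le_max_right (max a N) 0
    have hm3 := le_max_left a N
    have hm4 := le_max_right a N
    have hqpos : 0 < q := by linarith
    have hqbig : δ * (1 + B + ε) ≤ ε / 2 * q := by
      have : 2 * δ * (1 + B + ε) / ε ≤ q := by linarith
      rw [div_le_iff₀ hε] at this
      linarith
    obtain ⟨r, har, hrq, hqr, hr0, hrl, hPq⟩ := h.exists_lattice_near hδ (by linarith) hq0
    refine ⟨r, by linarith, hr0, hrl, fun i => ?_⟩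
    have h1 : |P q i - q * x i| ≤ ε / 2 * q := by
      have := hqx i
      have h2 : P q i - q * x i = (q⁻¹ * P q i - x i) * q := by field_simp
      rw [h2, abs_mul, abs_of_pos hqpos]
      exact mul_le_mul_of_nonneg_right this hqpos.le
    have h2 : |P q i - P r i| ≤ δ := by
      rw [hPq, line_apply, add_sub_cancel_left, abs_of_nonneg
        (mul_nonneg (sub_nonneg.2 hrq) (eVec_nonneg _ _))]
      have : eVec n 0 i ≤ 1 := by unfold eVec; split_ifs <;> norm_num
      nlinarith [eVec_nonneg 0 i]
    have h3 : |(q - r) * x i| ≤ δ * B := by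
      rw [abs_mul, abs_of_nonneg (sub_nonneg.2 hrq)]
      have : |x i| ≤ B := Finset.single_le_sum (f := fun i => |x i|)
        (fun i _ => abs_nonneg _) (Finset.mem_univ i)
      exact mul_le_mul (by linarith) this (abs_nonneg _) hδ.le
    rw [abs_le] at h1 h2 h3 ⊢
    constructor <;> nlinarith
  obtain ⟨b, hab, hb0, hbl, -⟩ := hrec a 1 one_pos
  have hself : lineFrom b (P b) b = P b := lineFrom_self _ _
  have hU : ∀ t ≥ b, glue (lineFrom b (P b)) P b t = P t := fun t ht => glue_of_ge hself ht
  refine ⟨glue (lineFrom b (P b)) P b, ⟨isGlobalSys_glue_lineFrom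
    (fun t ht => h.sum_eq t (le_trans hab ht)) (fun t ht => h.mono t (le_trans hab ht))
    (fun t ht => h.locallyRigid t (lt_of_le_of_lt hab ht)) hb0 hbl, fun M => ?_,
    fun N ε hε => ?_⟩, b, hab, hU⟩
  · obtain ⟨t, hat, ht⟩ := h.proper M
    refine ⟨max t b, fun i => ?_⟩
    rw [hU _ (le_max_right _ _)]
    exact (ht i).trans (h.coord_le hat (le_max_left _ _) i)
  · obtain ⟨r, hr, hr0, hrl, hrx⟩ := hrec (max N b) ε hε
    have hbr : b ≤ r := le_trans (le_max_right _ _) hr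
    refine ⟨r, le_trans (le_max_left _ _) hr, hr0.congr ?_, ?_, ?_⟩
    · filter_upwards [self_mem_nhdsWithin] with t ht using hU t (le_trans hbr ht)
    · rwa [hU r hbr]
    · rwa [hU r hbr]

end IsRaySys

lemma eq_Ici_of_isClosed_of_ordConnected {I : Set ℝ} (hc : IsClosed I) (ho : I.OrdConnected)
    (hb : BddBelow I) (hne : I.Nonempty) (ht : ∀ M : ℝ, ∃ q ∈ I, M ≤ q) : I = Ici (sInf I) := by
  have hmem := hc.csInf_mem hne hb
  refine Subset.antisymm (fun t ht => csInf_le hb ht) fun t h => ?_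
  obtain ⟨q, hq, hq'⟩ := ht t
  exact ho.out hmem hq ⟨h, hq'⟩

/-- A proper rigid system lives on a half-line. -/
lemma IsRigid.exists_isRaySys {n : ℕ} [NeZero n] {δ : ℝ} {I : Set ℝ} {P : ℝ → RVec n}
    (h : IsRigid n δ I P) (hp : IsProperSys n I P) : ∃ a, I = Ici a ∧ IsRaySys δ a P := by
  obtain ⟨⟨⟨hI0, hIo, hIne, hS⟩, hIc, hIpos, hnd⟩, hrig⟩ := h
  have hb : BddBelow I := ⟨0, fun t ht => hI0 ht⟩
  have hunb : ∀ M : ℝ, ∃ q ∈ I, M ≤ q := by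
    intro M
    obtain ⟨q, hq, hM⟩ := hp.2 (max M 0)
    refine ⟨q, hq, ?_⟩
    calc M ≤ P q 0 := (le_max_left _ _).trans (hM 0).le
      _ ≤ ∑ i, P q i := Finset.single_le_sum
        (fun i _ => (le_max_right M 0).trans (hM i).le) (Finset.mem_univ _)
      _ = q := (hS q hq).1.2.2
  obtain ⟨a, rfl⟩ : ∃ a, I = Ici a :=
    ⟨_, eq_Ici_of_isClosed_of_ordConnected hIc hIo hb (hIne.mono interior_subset) hunb⟩
  refine ⟨a, rfl, ?_⟩
  have hsw : ∀ q, IsSwitchNumber n (Ici a) P q → IsLatticePt δ (P q) :=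
    fun q hq => ⟨(hnd q hq).2, hrig q hq⟩
  refine ⟨fun t ht => (hS t ht).1.2.2, fun t ht => (hS t ht).1.2.1, fun t ht => ?_,
    fun t ht => ?_, hsw a ⟨self_mem_Ici, Or.inl ?_⟩, fun M => ?_⟩
  · obtain ⟨-, ε, hε, k, -, -, hk, -⟩ := hS t ht
    refine ⟨k, ?_⟩
    filter_upwards [Icc_mem_nhdsGE (show t < t + ε by linarith)] with s hs
    exact hk s ⟨le_trans ht hs.1, hs⟩
  · have hint : t ∈ interior (Ici a) := by rw [interior_Ici]; exact ht
    obtain ⟨-, ε, hε, k, l, hl, hk, hkl⟩ := hS t (le_of_lt ht)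
    refine ⟨k, l, ?_, ?_, hkl hint, fun hlt =>
      hsw t ⟨le_of_lt ht, Or.inr ⟨hint, ε, hε, k, l, hlt, hl, hk⟩⟩⟩
    · filter_upwards [Icc_mem_nhdsLE (show max a (t - ε) < t from max_lt ht (by linarith))]
        with s hs
      exact hl s ⟨(le_max_left _ _).trans hs.1, (le_max_right _ _).trans hs.1, hs.2⟩
    · filter_upwards [Icc_mem_nhdsGE (show t < t + ε by linarith)] with s hs
      exact hk s ⟨le_trans (le_of_lt ht) hs.1, hs⟩
  · rw [frontier_Ici]; rfl
  · obtain ⟨q, hq, hM⟩ := hp.2 M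
    exact ⟨q, hq, fun i => (hM i).le⟩

lemma IsGlobalSys.isRigid_Ici {n : ℕ} {δ : ℝ} {R : ℝ → RVec n} (h : IsGlobalSys δ R) {a : ℝ}
    (ha : 0 < a) (hl : IsLatticePt δ (R a)) (hpos : ∀ i, 0 < R a i) : IsRigid n δ (Ici a) R := by
  have hRpos : ∀ t ≥ a, ∀ i, 0 < R t i := fun t ht i => (hpos i).trans_le (h.coord_mono i ht)
  have hsw : ∀ q, IsSwitchNumber n (Ici a) R q → IsLatticePt δ (R q) := by
    rintro q ⟨hq, hf | ⟨hint, ε, hε, k, l, hkl, hL, hR⟩⟩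
    · rw [frontier_Ici] at hf
      rw [show q = a from hf]
      exact hl
    · rw [interior_Ici] at hint
      obtain ⟨k', l', h1, h2, -, h4⟩ := h.locallyRigid q
      have hL' : LeftSlope R q l := by
        filter_upwards [Icc_mem_nhdsLE (show max a (q - ε) < q from max_lt hint (by linarith))]
          with s hs
        exact hL s ⟨(le_max_left _ _).trans hs.1, (le_max_right _ _).trans hs.1, hs.2⟩
      have hR' : RightSlope R q k := by
        filter_upwards [Icc_mem_nhdsGE (show q < q + ε by linarith)] with s hs
        exact hR s ⟨le_trans hq hs.1, hs⟩
      obtain rfl := h1.unique hL'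
      obtain rfl := h2.unique hR'
      exact h4 hkl
  refine ⟨⟨⟨fun t ht => ha.le.trans ht, ordConnected_Ici, ⟨a + 1, ?_⟩, fun q hq =>
    ⟨⟨fun i => (hRpos q hq i).le, h.mono q, h.sum_eq q⟩, ?_⟩⟩, isClosed_Ici,
    fun t ht => ha.trans_le ht, fun q hq => ⟨hRpos q hq.1, (hsw q hq).1⟩⟩,
    fun q hq => (hsw q hq).2⟩
  · rw [interior_Ici]; exact lt_add_one a
  · obtain ⟨k, l, h1, h2, h3, -⟩ := h.locallyRigid q
    obtain ⟨u, hu, hu'⟩ := mem_nhdsLE_iff_exists_Icc_subset.1 h1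
    obtain ⟨v, hv, hv'⟩ := mem_nhdsGE_iff_exists_Icc_subset.1 h2
    have hu : u < q := hu
    have hv : q < v := hv
    refine ⟨min (q - u) (v - q), lt_min (sub_pos.2 hu) (sub_pos.2 hv), k, l, fun t ht => ?_,
      fun t ht => ?_, fun _ => h3⟩
    · exact hu' ⟨by linarith [ht.2.1, min_le_left (q - u) (v - q)], ht.2.2⟩
    · exact hv' ⟨ht.2.1, by linarith [ht.2.2, min_le_right (q - u) (v - q)]⟩

/-- Membership in `F(P)` in terms of approximations. -/
lemma mem_FSet_Ici_iff {n : ℕ} {a : ℝ} {P : ℝ → RVec n} {x : RVec n} :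
    x ∈ FSet n (Ici a) P ↔ ∀ N : ℝ, ∀ ε > 0, ∃ q ≥ N, ∀ i, |q⁻¹ * P q i - x i| ≤ ε := by
  constructor
  · rintro ⟨q, -, -, hq, hx⟩ N ε hε
    have h1 : ∀ᶠ j in atTop, ∀ i, |(q j)⁻¹ * P (q j) i - x i| ≤ ε := by
      refine eventually_all.2 fun i => ?_
      have := (tendsto_pi_nhds.1 hx i).eventually (Metric.closedBall_mem_nhds (x i) hε)
      filter_upwards [this] with j hj
      simpa [Real.dist_eq] using hj
    obtain ⟨j, hj, hj'⟩ := (h1.and (hq.eventually_ge_atTop N)).exists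
    exact ⟨q j, hj', hj⟩
  · intro h
    have hε : ∀ k : ℕ, (0 : ℝ) < 1 / (k + 1) := fun k => Nat.one_div_pos_of_nat
    choose f hf hfx using fun (k : ℕ) (N : ℝ) => h N _ (hε k)
    let q : ℕ → ℝ := fun k => Nat.rec (f 0 (max a 0)) (fun k q => f (k + 1) (q + 1)) k
    have hstep : ∀ k, q k + 1 ≤ q (k + 1) := fun k => hf (k + 1) (q k + 1)
    have hge : ∀ k : ℕ, max a 0 + k ≤ q k := by
      intro k
      induction k with
      | zero => simpa using max_le_iff.1 (show max a 0 ≤ q 0 from hf 0 (max a 0))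
      | succ k ih => push_cast; linarith [hstep k]
    have hqx : ∀ k i, |(q k)⁻¹ * P (q k) i - x i| ≤ 1 / ((k : ℝ) + 1) := by
      intro k
      cases k with
      | zero => exact hfx 0 (max a 0)
      | succ k => exact hfx (k + 1) (q k + 1)
    refine ⟨q, fun k => ?_, strictMono_nat_of_lt_succ fun k => by linarith [hstep k], ?_, ?_⟩
    · have : (0 : ℝ) ≤ k := Nat.cast_nonneg k
      exact le_trans (le_max_left a 0) (by linarith [hge k])
    · refine tendsto_atTop_mono (fun k => ?_) (tendsto_natCast_atTop_atTop (R := ℝ))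
      linarith [hge k, le_max_right a 0]
    · refine tendsto_pi_nhds.2 fun i => ?_
      rw [tendsto_iff_dist_tendsto_zero]
      refine squeeze_zero (fun _ => dist_nonneg) (fun k => ?_)
        tendsto_one_div_add_atTop_nhds_zero_nat
      simpa [Real.dist_eq] using hqx k i

lemma IsRaySys.exists_isRecurrentSys_of_mem_FSetE1 {n : ℕ} [NeZero n] {δ a : ℝ} {P : ℝ → RVec n}
    (h : IsRaySys δ a P) (hδ : 0 < δ) {x : RVec n} (hx : x ∈ FSetE1 n (Ici a) P) :
    ∃ U : ℝ → RVec n, IsRecurrentSys δ x U ∧ ∃ b ≥ a, ∀ t ≥ b, U t = P t := by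
  refine h.exists_isRecurrentSys hδ fun N ε hε => ?_
  obtain ⟨q, hqa, -, hq, hq0, hx⟩ := hx
  have h1 : ∀ᶠ j in atTop, ∀ i, |(q j)⁻¹ * P (q j) i - x i| ≤ ε := by
    refine eventually_all.2 fun i => ?_
    have := (tendsto_pi_nhds.1 hx i).eventually (Metric.closedBall_mem_nhds (x i) hε)
    filter_upwards [this] with j hj
    simpa [Real.dist_eq] using hj
  obtain ⟨j, hj, hj'⟩ := (h1.and (hq.eventually_ge_atTop N)).exists
  refine ⟨q j, hj', ?_, hj⟩
  obtain ⟨η, hη, hline⟩ := hq0 j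
  filter_upwards [Icc_mem_nhdsGE (show q j < q j + η by linarith)] with s hs
  exact hline s ⟨le_trans (hqa j) hs.1, hs⟩
/-- **Corollary (gluing two systems).** If `R⁽¹⁾` and `R⁽²⁾` are proper rigid
`n`-systems of the same mesh `δ` such that `F(R⁽¹⁾, e₁)` and `F(R⁽²⁾, e₁)` share a
point, then there is a proper rigid `n`-system `R` of mesh `δ` with
`F(R) = F(R⁽¹⁾) ∪ F(R⁽²⁾)`. -/
theorem union_of_FSets (n : ℕ) (hn : 2 ≤ n) (δ : ℝ) (hδ : 0 < δ)
    (I₁ I₂ : Set ℝ) (R₁ R₂ : ℝ → RVec n)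
    (hrig₁ : IsRigid n δ I₁ R₁) (hprop₁ : IsProperSys n I₁ R₁)
    (hrig₂ : IsRigid n δ I₂ R₂) (hprop₂ : IsProperSys n I₂ R₂)
    (hcommon : (FSetE1 n I₁ R₁ ∩ FSetE1 n I₂ R₂).Nonempty) :
    ∃ (J : Set ℝ) (R : ℝ → RVec n),
      IsRigid n δ J R ∧ IsProperSys n J R ∧
      FSet n J R = FSet n I₁ R₁ ∪ FSet n I₂ R₂ := by
  have : NeZero n := ⟨by omega⟩
  obtain ⟨a₁, rfl, hray₁⟩ := hrig₁.exists_isRaySys hprop₁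
  obtain ⟨a₂, rfl, hray₂⟩ := hrig₂.exists_isRaySys hprop₂
  obtain ⟨x, hx₁, hx₂⟩ := hcommon
  obtain ⟨U₁, hU₁, b₁, -, hUR₁⟩ := hray₁.exists_isRecurrentSys_of_mem_FSetE1 hδ hx₁
  obtain ⟨U₂, hU₂, b₂, -, hUR₂⟩ := hray₂.exists_isRecurrentSys_of_mem_FSetE1 hδ hx₂
  obtain ⟨a, ha, R, hR, hRl, hRpos, hRprop, hto, hfrom⟩ :=
    exists_alternating_sys hδ (P := fun k => if Even k then U₁ else U₂)
      (fun k => by split_ifs <;> assumption) fun k => by simp [Nat.even_add]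
  have hrig := hR.isRigid_Ici ha hRl hRpos
  refine ⟨Ici a, R, hrig, ⟨hrig.1.1, fun M => ?_⟩, Subset.antisymm (fun y hy => ?_) ?_⟩
  · obtain ⟨q, hq⟩ := hRprop (M + 1)
    refine ⟨max q a, le_max_right q a, fun i => ?_⟩
    linarith [hq i, hR.coord_mono i (le_max_left q a)]
  · rw [mem_FSet_Ici_iff] at hy
    by_contra hcon
    rw [mem_union, mem_FSet_Ici_iff, mem_FSet_Ici_iff] at hcon
    push Not at hcon
    obtain ⟨⟨N₁, ε₁, hε₁, h₁⟩, ⟨N₂, ε₂, hε₂, h₂⟩⟩ := hcon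
    have hε : 0 < min ε₁ ε₂ / 2 := half_pos (lt_min hε₁ hε₂)
    obtain ⟨Q, hQ⟩ := hto (max (max N₁ b₁) (max N₂ b₂)) _ hε
    obtain ⟨q, hqQ, hqy⟩ := hy Q _ hε
    obtain ⟨k, t, ht, hclose⟩ := hQ q hqQ
    obtain ⟨ht1, ht2⟩ := max_le_iff.1 ht
    have hty : ∀ i, |t⁻¹ * (if Even k then U₁ else U₂) t i - y i| ≤ min ε₁ ε₂ := by
      intro i
      have := hclose i
      have := hqy i
      rw [abs_le] at *
      constructor <;> linarith
    split_ifs at hty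
    · obtain ⟨i, hi⟩ := h₁ t (max_le_iff.1 ht1).1
      rw [← hUR₁ t (max_le_iff.1 ht1).2] at hi
      exact absurd ((hty i).trans (min_le_left _ _)) (not_le.2 hi)
    · obtain ⟨i, hi⟩ := h₂ t (max_le_iff.1 ht2).1
      rw [← hUR₂ t (max_le_iff.1 ht2).2] at hi
      exact absurd ((hty i).trans (min_le_right _ _)) (not_le.2 hi)
  · have key : ∀ (k : ℕ) (U P : ℝ → RVec n) (a' b : ℝ), (if Even k then U₁ else U₂) = U →
        (∀ t ≥ b, U t = P t) → FSet n (Ici a') P ⊆ FSet n (Ici a) R := by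
      rintro k U P a' b rfl hUP y hy
      rw [mem_FSet_Ici_iff] at hy ⊢
      intro N ε hε
      obtain ⟨T, hT⟩ := hfrom k N _ (half_pos hε)
      obtain ⟨t, ht, hty⟩ := hy (max T b) _ (half_pos hε)
      obtain ⟨q, hq, hclose⟩ := hT t (le_trans (le_max_left _ _) ht)
      refine ⟨q, hq, fun i => ?_⟩
      have h1 := hclose i
      have h2 := hty i
      simp only [hUP t (le_trans (le_max_right _ _) ht)] at h1
      rw [abs_le] at *
      constructor <;> linarith
    exact union_subset (key 0 U₁ R₁ a₁ b₁ (by simp) hUR₁) (key 1 U₂ R₂ a₂ b₂ (by simp) hUR₂)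
end
end

section
/- Let n ≥ 2 and let (P^(i))_{i≥1} be a sequence of proper n-systems. Then there exists a proper n-system R such that liminf_{i→∞} F(P^(i)) ⊆ F(R) ⊆ limsup_{i→∞} F(P^(i)). -/
open Filter Set Pointwise Topology

noncomputable section

section Trajectories

variable {n : ℕ}

theorem eVec_apply (k i : Fin n) : eVec n k i = if i = k then 1 else 0 := by
  simp [eVec, Fin.ext_iff]

theorem add_smul_eVec_same (a : RVec n) (t : ℝ) (k : Fin n) :
    (a + t • eVec n k) k = a k + t := by
  simp [eVec_apply]

theorem add_smul_eVec_of_ne (a : RVec n) (t : ℝ) {k i : Fin n} (h : i ≠ k) :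
    (a + t • eVec n k) i = a i := by
  simp [eVec_apply, h]

theorem sum_add_smul_eVec (a : RVec n) (t : ℝ) (k : Fin n) :
    ∑ i, (a + t • eVec n k) i = ∑ i, a i + t := by
  simp [eVec_apply, Finset.sum_add_distrib]

theorem smul_eVec_injective {t : ℝ} (ht : t ≠ 0) {a : RVec n} {k l : Fin n}
    (h : a + t • eVec n k = a + t • eVec n l) : k = l := by
  by_contra hne
  have h1 := congrFun h k
  rw [add_smul_eVec_same, add_smul_eVec_of_ne _ _ hne] at h1
  exact ht (by linarith)

/-- Condition (S3) on consecutive slopes `e_l`, `e_k` at the point `a`. -/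
def SlopeChange (a : RVec n) (l k : Fin n) : Prop :=
  ∀ i : Fin n, l ≤ i → i ≤ k → a i = a l

theorem SlopeChange.of_le (a : RVec n) {l k : Fin n} (h : k ≤ l) : SlopeChange a l k := by
  intro i h1 h2
  rw [le_antisymm (h2.trans h) h1]

theorem SlopeChange.trans {a : RVec n} {l m k : Fin n} (h1 : SlopeChange a l m)
    (h2 : SlopeChange a m k) : SlopeChange a l k := by
  intro i hl hk
  rcases le_total i m with him | him
  · exact h1 i hl him
  · rcases le_total l m with hlm | hlm
    · rw [h2 i him hk, h1 m hlm le_rfl]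
    · rw [h2 i him hk, h2 l hlm (hl.trans hk)]

/-- One move of a trajectory inside `S`: from the point `s.1` reached with slope `e_{s.2}`, raise
the coordinate `s'.2` in order to reach `s'.1`. -/
def RaiseStep (S : Set (RVec n)) (s s' : RVec n × Fin n) : Prop :=
  SlopeChange s.1 s.2 s'.2 ∧ ∃ t : ℝ, 0 ≤ t ∧ s'.1 = s.1 + t • eVec n s'.2 ∧
    ∀ u, 0 ≤ u → u ≤ t → s.1 + u • eVec n s'.2 ∈ S

/-- A finite trajectory inside `S`. -/
abbrev RaisePath (S : Set (RVec n)) : RVec n × Fin n → RVec n × Fin n → Prop :=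
  Relation.ReflTransGen (RaiseStep S)

theorem RaiseStep.sum_le {S : Set (RVec n)} {s s' : RVec n × Fin n} (h : RaiseStep S s s') :
    ∑ i, s.1 i ≤ ∑ i, s'.1 i := by
  obtain ⟨-, t, ht, h, -⟩ := h
  rw [h, sum_add_smul_eVec]
  linarith

theorem RaisePath.sum_le {S : Set (RVec n)} {s s' : RVec n × Fin n} (h : RaisePath S s s') :
    ∑ i, s.1 i ≤ ∑ i, s'.1 i := by
  induction h with
  | refl => exact le_rfl
  | tail _ h2 ih => exact ih.trans h2.sum_le

theorem real_induction {a b : ℝ} (hab : a ≤ b) {p : ℝ → Prop} (ha : p a)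
    (hr : ∀ x, a ≤ x → x < b → p x → ∃ y, x < y ∧ y ≤ b ∧ p y)
    (hl : ∀ x, a < x → x ≤ b → ∃ ε > 0, ∀ y, a ≤ y → y < x → x - ε ≤ y → p y → p x) :
    p b := by
  set T : Set ℝ := {x | a ≤ x ∧ x ≤ b ∧ p x} with hT
  have hne : T.Nonempty := ⟨a, le_rfl, hab, ha⟩
  have hbd : BddAbove T := ⟨b, fun x hx => hx.2.1⟩
  set c := sSup T with hc
  have hac : a ≤ c := le_csSup hbd ⟨le_rfl, hab, ha⟩
  have hcb : c ≤ b := csSup_le hne fun x hx => hx.2.1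
  have hpc : p c := by
    rcases hac.eq_or_lt with h | h
    · rwa [← h]
    · obtain ⟨ε, hε, H⟩ := hl c h hcb
      obtain ⟨y, hy, hy'⟩ := exists_lt_of_lt_csSup hne (show c - ε < sSup T by linarith)
      rcases (le_csSup hbd hy).eq_or_lt with h' | h'
      · rw [hc, ← h']; exact hy.2.2
      · exact H y hy.1 h' hy'.le hy.2.2
  rcases hcb.eq_or_lt with h | h
  · rwa [← h]
  · obtain ⟨y, hy, hyb, hpy⟩ := hr c hac h hpc
    exact absurd (le_csSup hbd (show y ∈ T from ⟨hac.trans hy.le, hyb, hpy⟩)) (not_le.2 hy)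

/-- On a right neighbourhood of `q` in `I`, the map `P` has slope `e_k`. -/
def HasRightSlope (I : Set ℝ) (P : ℝ → RVec n) (q : ℝ) (k : Fin n) : Prop :=
  ∃ ε > (0 : ℝ), ∀ t ∈ I ∩ Set.Icc q (q + ε), P t = P q + (t - q) • eVec n k

section System

variable {I : Set ℝ} {P : ℝ → RVec n}

theorem IsProperSys.neZero (h : IsProperSys n I P) : NeZero n := by
  refine ⟨fun h0 => ?_⟩
  subst h0
  obtain ⟨x, hx⟩ := h.1.2.2.1
  have hI := interior_subset (s := I)
  obtain ⟨y, hy, hyx⟩ : ∃ y ∈ interior I, y ≠ x := by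
    have := (isOpen_interior (s := I)).mem_nhds hx
    obtain ⟨e, he, hb⟩ := Metric.mem_nhds_iff.1 this
    refine ⟨x + e / 2, hb ?_, by linarith⟩
    rw [Metric.mem_ball, Real.dist_eq, add_sub_cancel_left, abs_of_pos (by linarith)]
    linarith
  have h1 := (h.1.2.2.2 x (hI hx)).1.2.2
  have h2 := (h.1.2.2.2 y (hI hy)).1.2.2
  simp at h1 h2
  exact hyx (by rw [← h1, ← h2])

theorem IsProperSys.exists_gt (h : IsProperSys n I P) (N : ℝ) : ∃ q ∈ I, N < q := by
  have := h.neZero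
  obtain ⟨q, hq, hM⟩ := h.2 |N|
  refine ⟨q, hq, ?_⟩
  obtain ⟨⟨h0, -, hs⟩, -⟩ := h.1.2.2.2 q hq
  calc N ≤ |N| := le_abs_self N
    _ < P q 0 := hM 0
    _ ≤ ∑ i, P q i := Finset.single_le_sum (fun i _ => h0 i) (Finset.mem_univ _)
    _ = q := hs

theorem IsProperSys.mem_of_le (h : IsProperSys n I P) {q r : ℝ} (hq : q ∈ I) (hr : q ≤ r) :
    r ∈ I := by
  obtain ⟨s, hs, hrs⟩ := h.exists_gt r
  exact h.1.2.1.out hq hs ⟨hr, hrs.le⟩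

theorem IsProperSys.mem_interior (h : IsProperSys n I P) {q r : ℝ} (hq : q ∈ I) (hr : q < r) :
    r ∈ interior I :=
  interior_maximal (fun _ hx => h.mem_of_le hq (le_of_lt hx)) isOpen_Ioi hr

theorem HasRightSlope.unique (h : IsProperSys n I P) {q : ℝ} (hq : q ∈ I) {k : Fin n}
    (hk : HasRightSlope I P q k) {l : Fin n} {r : ℝ} (hr : q < r)
    (hl : ∀ t, q ≤ t → t ≤ r → P t = P q + (t - q) • eVec n l) : k = l := by
  obtain ⟨ε, hε, H⟩ := hk
  have h1 := H (min r (q + ε)) ⟨h.mem_of_le hq (le_min hr.le (by linarith)),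
    le_min hr.le (by linarith), min_le_right _ _⟩
  rw [hl _ (le_min hr.le (by linarith)) (min_le_left _ _)] at h1
  refine (smul_eVec_injective ?_ h1).symm
  have : q < min r (q + ε) := lt_min hr (by linarith)
  linarith

/-- If `P` has slope `e_l` between `y` and `x`, formulated from `x`, the same holds from `y`. -/
theorem slope_from_left {x y : ℝ} (hyx : y ≤ x) {l : Fin n}
    (H : ∀ t, y ≤ t → t ≤ x → P t = P x + (t - x) • eVec n l) {t : ℝ} (h1 : y ≤ t) (h2 : t ≤ x) :
    P t = P y + (t - y) • eVec n l := by
  rw [H t h1 h2, H y le_rfl hyx, add_assoc, ← add_smul]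
  congr 2
  ring

/-- A slope `e_k` with which the trajectory may arrive at `P q`. -/
def AdmissibleSlope (I : Set ℝ) (P : ℝ → RVec n) (q : ℝ) (k : Fin n) : Prop :=
  ∃ k', HasRightSlope I P q k' ∧ SlopeChange (P q) k k'

theorem IsProperSys.left_slope (h : IsProperSys n I P) {a x : ℝ} (ha : a ∈ I) (hx : a < x) :
    ∃ ε > (0 : ℝ), ∃ l : Fin n, AdmissibleSlope I P x l ∧
      ∀ t ∈ I ∩ Set.Icc (x - ε) x, P t = P x + (t - x) • eVec n l := by
  obtain ⟨-, ε, hε, k, l, hL, hR, hS⟩ := h.1.2.2.2 x (h.mem_of_le ha hx.le)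
  refine ⟨ε, hε, l, ⟨k, ⟨ε, hε, hR⟩, ?_⟩, hL⟩
  rcases lt_or_ge l k with hlk | hlk
  · exact hS (h.mem_interior ha hx) hlk
  · exact SlopeChange.of_le _ hlk

theorem IsProperSys.exists_path (h : IsProperSys n I P) {a b : ℝ} (ha : a ∈ I) (hab : a ≤ b)
    {k : Fin n} (hk : AdmissibleSlope I P a k) :
    ∃ l, AdmissibleSlope I P b l ∧ RaisePath (P '' Set.Icc a b) (P a, k) (P b, l) := by
  have step : ∀ {y x : ℝ} {m k' : Fin n}, a ≤ y → y ≤ x → x ≤ b → SlopeChange (P y) m k' →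
      (∀ t, y ≤ t → t ≤ x → P t = P y + (t - y) • eVec n k') →
      RaiseStep (P '' Set.Icc a b) (P y, m) (P x, k') := by
    intro y x m k' hay hyx hxb hm H
    refine ⟨hm, x - y, by linarith, H x hyx le_rfl, fun u hu hu' => ?_⟩
    refine ⟨y + u, ⟨by linarith, by linarith⟩, ?_⟩
    rw [H (y + u) (by linarith) (by linarith), add_sub_cancel_left]
  refine real_induction (p := fun q => ∃ l, AdmissibleSlope I P q l ∧
    RaisePath (P '' Set.Icc a b) (P a, k) (P q, l)) hab ⟨k, hk, .refl⟩ ?_ ?_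
  · rintro x hax hxb ⟨l, ⟨k', ⟨ε, hε, hR⟩, hlk⟩, hpath⟩
    have hxI := h.mem_of_le ha hax
    set y := min b (x + ε) with hy
    have hxy : x < y := lt_min hxb (by linarith)
    have hyb : y ≤ b := min_le_left _ _
    have hyε : y ≤ x + ε := min_le_right _ _
    have H : ∀ t, x ≤ t → t ≤ y → P t = P x + (t - x) • eVec n k' := fun t h1 h2 =>
      hR t ⟨h.mem_of_le hxI h1, h1, h2.trans hyε⟩
    refine ⟨y, hxy, hyb, k', ?_, hpath.tail (step hax hxy.le hyb hlk H)⟩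
    obtain ⟨ε', hε', l', hl', hL⟩ := h.left_slope hxI hxy
    set z := max x (y - ε') with hz
    have hzy : z < y := max_lt hxy (by linarith)
    have hxz : x ≤ z := le_max_left _ _
    have hzl : ∀ t, z ≤ t → t ≤ y → P t = P z + (t - z) • eVec n l' := fun t h1 h2 =>
      slope_from_left (x := y) hzy.le (fun s hs hs' => hL s
        ⟨h.mem_of_le hxI (hxz.trans hs), (le_max_right _ _).trans hs, hs'⟩) h1 h2
    have hzk : HasRightSlope I P z k' := by
      refine ⟨y - z, by linarith, fun t ht => ?_⟩
      rw [H t (hxz.trans ht.2.1) (by linarith [ht.2.2]), H z hxz hzy.le, add_assoc, ← add_smul]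
      congr 2
      ring
    rw [hzk.unique h (h.mem_of_le hxI hxz) hzy hzl]
    exact hl'
  · intro x hax hxb
    obtain ⟨ε, hε, l, hl, hL⟩ := h.left_slope ha hax
    refine ⟨ε, hε, fun y hay hyx hεy => ?_⟩
    rintro ⟨m, ⟨k', hk', hmk⟩, hpath⟩
    have hyI := h.mem_of_le ha hay
    have H : ∀ t, y ≤ t → t ≤ x → P t = P y + (t - y) • eVec n l := fun t h1 h2 =>
      slope_from_left hyx.le (fun s hs hs' => hL s
        ⟨h.mem_of_le hyI hs, hεy.trans hs, hs'⟩) h1 h2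
    have := hk'.unique h hyI hyx H
    subst this
    exact ⟨k', hl, hpath.tail (step hay hyx.le hxb hmk H)⟩

theorem IsProperSys.exists_right_slope_zero [NeZero n] (h : IsProperSys n I P) (N : ℝ) :
    ∃ q ∈ I, N < q ∧ HasRightSlope I P q 0 := by
  obtain ⟨a, haI, haN⟩ := h.exists_gt N
  by_contra! hcon
  obtain ⟨b, hbI, hb⟩ := h.2 a
  have hle : ∀ q ∈ I, P q 0 ≤ q := fun q hq => by
    obtain ⟨⟨h0, -, hs⟩, -⟩ := h.1.2.2.2 q hq
    calc P q 0 ≤ ∑ i, P q i := Finset.single_le_sum (fun i _ => h0 i) (Finset.mem_univ _)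
      _ = q := hs
  have hab : a < b := (hb 0).trans_le (hle b hbI)
  have key : P b 0 = P a 0 := by
    refine real_induction (p := fun q => P q 0 = P a 0) hab.le rfl ?_ ?_
    · intro x hax hxb hx
      have hxI := h.mem_of_le haI hax
      obtain ⟨-, ε, hε, k, -, -, hR, -⟩ := h.1.2.2.2 x hxI
      have hk : (0 : Fin n) ≠ k := by
        rintro rfl
        exact hcon x hxI (by linarith) ⟨ε, hε, hR⟩
      have hlt : x < min b (x + ε) := lt_min hxb (by linarith)
      refine ⟨min b (x + ε), hlt, min_le_left _ _, ?_⟩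
      rw [hR _ ⟨h.mem_of_le hxI hlt.le, hlt.le, min_le_right _ _⟩,
        add_smul_eVec_of_ne _ _ hk, hx]
    · intro x hax hxb
      obtain ⟨ε, hε, l, -, hL⟩ := h.left_slope haI hax
      refine ⟨ε, hε, fun y hay hyx hεy hy => ?_⟩
      have hyI := h.mem_of_le haI hay
      have H : ∀ t, y ≤ t → t ≤ x → P t = P y + (t - y) • eVec n l := fun t h1 h2 =>
        slope_from_left hyx.le (fun s hs hs' => hL s
          ⟨h.mem_of_le hyI hs, hεy.trans hs, hs'⟩) h1 h2
      have hl : (0 : Fin n) ≠ l := by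
        rintro rfl
        refine hcon y hyI (by linarith) ?_
        obtain ⟨-, ε', hε', k, -, -, hR, -⟩ := h.1.2.2.2 y hyI
        have := HasRightSlope.unique h hyI ⟨ε', hε', hR⟩ hyx H
        subst this
        exact ⟨ε', hε', hR⟩
      rw [H x hyx.le le_rfl, add_smul_eVec_of_ne _ _ hl, hy]
  linarith [hb 0, hle a haI]

end System

theorem raiseStep_zero {S : Set (RVec n)} {a : RVec n} (ha : a ∈ S) {k l : Fin n}
    (h : SlopeChange a k l) : RaiseStep S (a, k) (a, l) := by
  refine ⟨h, 0, le_rfl, by simp, fun u hu hu' => ?_⟩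
  obtain rfl := le_antisymm hu' hu
  simpa using ha

theorem raise_mem_box {a b : RVec n} (ha : Monotone a) (hb : Monotone b) (hab : a ≤ b) {k : Fin n}
    (hk : ∀ j, k < j → a j = b j) {u : ℝ} (hu : 0 ≤ u) (hu' : u ≤ b k - a k) :
    Monotone (a + u • eVec n k) ∧ a ≤ a + u • eVec n k ∧ a + u • eVec n k ≤ b := by
  refine ⟨fun i j hij => ?_, fun j => ?_, fun j => ?_⟩
  · by_cases hi : i = k
    · by_cases hj : j = k
      · rw [hi, hj]
      · subst hi
        rw [add_smul_eVec_same, add_smul_eVec_of_ne _ _ hj,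
          hk j (lt_of_le_of_ne hij (Ne.symm hj))]
        linarith [hb hij]
    · rw [add_smul_eVec_of_ne _ _ hi]
      by_cases hj : j = k
      · subst hj
        rw [add_smul_eVec_same]
        linarith [ha hij]
      · rw [add_smul_eVec_of_ne _ _ hj]
        exact ha hij
  · by_cases hj : j = k
    · subst hj
      rw [add_smul_eVec_same]
      linarith
    · rw [add_smul_eVec_of_ne _ _ hj]
  · by_cases hj : j = k
    · subst hj
      rw [add_smul_eVec_same]
      linarith
    · rw [add_smul_eVec_of_ne _ _ hj]
      exact hab j

/-- One can go from `a` to any `b ≥ a` by raising coordinates in decreasing order, as long as the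
coordinates above the current slope are already in place. -/
theorem raisePath_of_le [NeZero n] {S : Set (RVec n)} {b : RVec n} (hb : Monotone b)
    (k : Fin n) (a : RVec n) (ha : Monotone a) (hab : a ≤ b) (hk : ∀ j, k < j → a j = b j)
    (hS : ∀ v, Monotone v → a ≤ v → v ≤ b → v ∈ S) : RaisePath S (a, k) (b, 0) := by
  obtain ⟨m, hm⟩ : ∃ m : ℕ, k.val = m := ⟨_, rfl⟩
  induction m generalizing k a with
  | zero =>
    obtain rfl : k = 0 := Fin.ext (by simpa using hm)
    refine .single ⟨SlopeChange.of_le _ le_rfl, b 0 - a 0, by linarith [hab 0], ?_, fun u hu hu' =>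
      have hbox := raise_mem_box ha hb hab hk hu hu'
      hS _ hbox.1 hbox.2.1 hbox.2.2⟩
    funext j
    by_cases hj : j = 0
    · subst hj
      simp only [add_smul_eVec_same]
      ring
    · rw [add_smul_eVec_of_ne _ _ hj]
      exact (hk j (lt_of_le_of_ne (Fin.zero_le _) (Ne.symm hj))).symm
  | succ m ih =>
    have hk0 : 0 ≤ b k - a k := by linarith [hab k]
    set a' : RVec n := a + (b k - a k) • eVec n k with ha'
    obtain ⟨h1, h2, h3⟩ := raise_mem_box ha hb hab hk hk0 le_rfl
    have hkn := k.isLt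
    set k' : Fin n := ⟨m, by omega⟩ with hk'
    have hk'k : k' ≤ k := by rw [Fin.le_def]; simp [hk', hm]
    refine .head (b := (a', k)) ⟨SlopeChange.of_le _ le_rfl, _, hk0, rfl, fun u hu hu' =>
      have hbox := raise_mem_box ha hb hab hk hu hu'
      hS _ hbox.1 hbox.2.1 hbox.2.2⟩
      (.head (raiseStep_zero (hS _ h1 h2 h3) (SlopeChange.of_le _ hk'k)) ?_)
    refine ih k' a' h1 h3 (fun j hj => ?_) (fun v hv hv' => hS v hv (h2.trans hv')) rfl
    by_cases hjk : j = k
    · subst hjk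
      rw [ha', add_smul_eVec_same]
      ring
    · rw [ha', add_smul_eVec_of_ne _ _ hjk]
      refine hk j (lt_of_le_of_ne ?_ (Ne.symm hjk))
      rw [Fin.lt_def] at hj
      rw [Fin.le_def]
      simp only [hk'] at hj
      omega

theorem RaisePath.backtrack {S : Set (RVec n)} {s s' : RVec n × Fin n} (h : RaisePath S s s')
    {p : Fin n → Prop} (hp : ∀ i j, i ≤ j → p i → p j) :
    ∃ r, RaisePath S s r ∧ r.1 ≤ s'.1 ∧ (∀ j, p j → r.1 j = s'.1 j) ∧
      ((∀ j, r.2 < j → p j) ∨ r = s) := by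
  induction h with
  | refl => exact ⟨s, .refl, le_rfl, fun _ _ => rfl, .inr rfl⟩
  | @tail b c h1 h2 ih =>
    by_cases hc : ∀ j, c.2 < j → p j
    · exact ⟨c, h1.tail h2, le_rfl, fun _ _ => rfl, .inl hc⟩
    · push Not at hc
      obtain ⟨j, hj, hpj⟩ := hc
      obtain ⟨r, hr, hrb, hpr, hor⟩ := ih
      obtain ⟨-, t, ht, hbc, -⟩ := h2
      refine ⟨r, hr, hrb.trans ?_, fun i hi => ?_, hor⟩
      · intro i
        rw [hbc]
        by_cases hi : i = c.2
        · subst hi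
          rw [add_smul_eVec_same]
          linarith
        · rw [add_smul_eVec_of_ne _ _ hi]
      · rw [hpr i hi, hbc, add_smul_eVec_of_ne]
        rintro rfl
        exact hpj (hp _ _ hj.le hi)

theorem RaisePath.map {S T : Set (RVec n)} {ψ : ℝ → ℝ} (hψ : Monotone ψ) {near : ℝ → ℝ → Prop}
    (hnear : ∀ a t, 0 ≤ a → 0 ≤ t → ∀ y, ψ a ≤ y → y ≤ ψ (a + t) →
      ∃ u, 0 ≤ u ∧ u ≤ t ∧ near (a + u) y)
    (hS : ∀ v ∈ S, Monotone v ∧ ∀ j, 0 ≤ v j)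
    (hT : ∀ v ∈ S, ∀ z : RVec n, Monotone z → (∀ j, near (v j) (z j)) → z ∈ T)
    {s s' : RVec n × Fin n} (h : RaisePath S s s') :
    RaisePath T (ψ ∘ s.1, s.2) (ψ ∘ s'.1, s'.2) := by
  have hn0 : ∀ y, 0 ≤ y → near y (ψ y) := fun y hy => by
    obtain ⟨u, hu, hu', h⟩ := hnear y 0 hy le_rfl (ψ y) le_rfl (by simp)
    obtain rfl := le_antisymm hu' hu
    simpa using h
  refine Relation.ReflTransGen.lift (fun r : RVec n × Fin n => (ψ ∘ r.1, r.2)) ?_ _ _ h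
  rintro ⟨a, l⟩ ⟨b, k⟩ ⟨hlk, t, ht, hb, hseg⟩
  simp only at hlk hb hseg
  subst hb
  refine ⟨fun i h1 h2 => congrArg ψ (hlk i h1 h2), ψ (a k + t) - ψ (a k),
    sub_nonneg.2 (hψ (by linarith)), ?_, ?_⟩
  · funext j
    simp only [Function.comp]
    by_cases hj : j = k
    · subst hj
      rw [add_smul_eVec_same, add_smul_eVec_same, Function.comp_apply]
      ring
    · rw [add_smul_eVec_of_ne _ _ hj, add_smul_eVec_of_ne _ _ hj, Function.comp_apply]
  · intro u hu hu'
    simp only at hu' ⊢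
    have ha := hseg 0 le_rfl ht
    rw [zero_smul, add_zero] at ha
    obtain ⟨w, hw, hwt, hnw⟩ := hnear (a k) t ((hS a ha).2 k) ht (ψ (a k) + u)
      (by linarith) (by linarith)
    refine hT _ (hseg w hw hwt) _ ?_ ?_
    · intro i j hij
      by_cases hi : i = k
      · by_cases hj : j = k
        · rw [hi, hj]
        · subst hi
          rw [add_smul_eVec_same, add_smul_eVec_of_ne _ _ hj]
          have := (hS _ (hseg t ht le_rfl)).1 hij
          rw [add_smul_eVec_same, add_smul_eVec_of_ne _ _ hj] at this
          have := hψ this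
          simp only [Function.comp]
          linarith
      · rw [add_smul_eVec_of_ne _ _ hi]
        have := hψ ((hS a ha).1 hij)
        by_cases hj : j = k
        · subst hj
          rw [add_smul_eVec_same]
          simp only [Function.comp]
          linarith
        · rw [add_smul_eVec_of_ne _ _ hj]
          exact this
    · intro j
      by_cases hj : j = k
      · subst hj
        rw [add_smul_eVec_same, add_smul_eVec_same]
        exact hnw
      · rw [add_smul_eVec_of_ne _ _ hj, add_smul_eVec_of_ne _ _ hj]
        refine hn0 _ ?_
        exact (hS a ha).2 j

/-- A monotone map close to the identity which is constant near each point of `V`. -/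
theorem exists_monotone_flattening (V : Set ℝ) {c ε : ℝ} (hc : 0 ≤ c) (hε : 0 < ε) :
    ∃ φ : ℝ → ℝ, Monotone φ ∧
      (∀ y, 0 ≤ y → c ≤ φ y ∧ |φ y - y| ≤ ε * y + c ∧ φ y ≤ max c ((1 + ε) * y)) ∧
      ∀ v ∈ V, c ≤ v → ∀ y, 0 ≤ y → v ≤ (1 + ε) * y → y ≤ (1 + ε) * v →
        (∀ w ∈ V, w ≤ (1 + ε) ^ 2 * v → w ≤ v) → φ y = v := by
  have h1 : 0 < 1 + ε := by linarith
  set A : ℝ → Set ℝ := fun y => {w | w ≤ c ∨ (1 + ε) * w ≤ y ∨ (w ∈ V ∧ w ≤ (1 + ε) * y)} with hA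
  have hcA : ∀ y, c ∈ A y := fun y => Or.inl le_rfl
  have hle : ∀ y, 0 ≤ y → ∀ w ∈ A y, w ≤ max c ((1 + ε) * y) := by
    rintro y hy w (h | h | h)
    · exact h.trans (le_max_left _ _)
    · refine le_trans ?_ (le_max_right _ _)
      by_contra! hcon
      have hw : 0 ≤ w := by nlinarith
      nlinarith [mul_nonneg hε.le hw, mul_nonneg hε.le hy]
    · exact h.2.trans (le_max_right _ _)
  have hbd : ∀ y, BddAbove (A y) := fun y => by
    refine ⟨max c ((1 + ε) * |y|), fun w hw => hle |y| (abs_nonneg y) w ?_⟩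
    have := le_abs_self y
    rcases hw with h | h | h
    · exact Or.inl h
    · exact Or.inr (Or.inl (h.trans this))
    · exact Or.inr (Or.inr ⟨h.1, h.2.trans (by gcongr)⟩)
  refine ⟨fun y => sSup (A y), ?_, ?_, ?_⟩
  · intro y z hyz
    refine csSup_le_csSup (hbd z) ⟨c, hcA y⟩ ?_
    rintro w (h | h | h)
    · exact Or.inl h
    · exact Or.inr (Or.inl (h.trans hyz))
    · exact Or.inr (Or.inr ⟨h.1, h.2.trans (by gcongr)⟩)
  · intro y hy
    have hup : sSup (A y) ≤ max c ((1 + ε) * y) := csSup_le ⟨c, hcA y⟩ (hle y hy)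
    have hlo : y / (1 + ε) ≤ sSup (A y) :=
      le_csSup (hbd y) (Or.inr (Or.inl (by rw [mul_div_cancel₀ _ h1.ne'])))
    have hlo' : y - ε * y ≤ y / (1 + ε) := by
      rw [le_div_iff₀ h1]
      nlinarith [mul_nonneg (mul_nonneg hε.le hε.le) hy]
    have hmax : max c ((1 + ε) * y) ≤ (1 + ε) * y + c :=
      max_le (by nlinarith) (by linarith)
    refine ⟨le_csSup (hbd y) (hcA y), abs_le.2 ⟨by linarith, by linarith⟩, hup⟩
  · intro v hv hcv y hy hvy hyv hsep
    refine le_antisymm (csSup_le ⟨c, hcA y⟩ ?_) (le_csSup (hbd y) (Or.inr (Or.inr ⟨hv, hvy⟩)))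
    rintro w (h | h | h)
    · exact h.trans hcv
    · nlinarith
    · exact hsep w h.1 (h.2.trans (by nlinarith))

/-- `f` restricts to an `n`-system on `[c, ∑ i, s.1 i]` that ends at the point `s.1` with a slope
compatible with `s.2`. -/
structure IsPartialSystem (c : ℝ) (s : RVec n × Fin n) (f : ℝ → RVec n) : Prop where
  le_sum : c ≤ ∑ i, s.1 i
  apply_sum : f (∑ i, s.1 i) = s.1
  basic : ∀ q, c ≤ q → q ≤ ∑ i, s.1 i → (∀ i, 0 ≤ f q i) ∧ Monotone (f q) ∧ ∑ i, f q i = q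
  slopes : ∀ q, c ≤ q → q < ∑ i, s.1 i → ∃ ε > (0 : ℝ), q + ε ≤ ∑ i, s.1 i ∧ ∃ k l : Fin n,
    (∀ t, c ≤ t → q - ε ≤ t → t ≤ q → f t = f q + (t - q) • eVec n l) ∧
    (∀ t, q ≤ t → t ≤ q + ε → f t = f q + (t - q) • eVec n k) ∧ SlopeChange (f q) l k
  last : ∃ ε > (0 : ℝ), ∃ l : Fin n, (∀ t, c ≤ t → ∑ i, s.1 i - ε ≤ t → t ≤ ∑ i, s.1 i →
    f t = s.1 + (t - ∑ i, s.1 i) • eVec n l) ∧ SlopeChange s.1 l s.2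

theorem IsPartialSystem.start {s : RVec n × Fin n} (h0 : ∀ i, 0 ≤ s.1 i) (hm : Monotone s.1) :
    IsPartialSystem (∑ i, s.1 i) s fun _ => s.1 where
  le_sum := le_rfl
  apply_sum := rfl
  basic q h1 h2 := ⟨h0, hm, le_antisymm h1 h2⟩
  slopes q h1 h2 := absurd h2 (not_lt.2 h1)
  last := ⟨1, one_pos, s.2, fun t h1 _ h2 => by simp [le_antisymm h2 h1],
    SlopeChange.of_le _ le_rfl⟩

theorem IsPartialSystem.extend_step {c : ℝ} {s s' : RVec n × Fin n} {f : ℝ → RVec n}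
    (hf : IsPartialSystem c s f) {S : Set (RVec n)} (hS : ∀ v ∈ S, Monotone v ∧ ∀ i, 0 ≤ v i)
    (h : RaiseStep S s s') :
    ∃ g, IsPartialSystem c s' g ∧ (∀ q, q ≤ ∑ i, s.1 i → g q = f q) ∧
      ∀ q, ∑ i, s.1 i ≤ q → q ≤ ∑ i, s'.1 i → g q ∈ S := by
  obtain ⟨a, l⟩ := s
  obtain ⟨b, k⟩ := s'
  obtain ⟨hlk, t, ht, hb, hseg⟩ := h
  simp only at hlk hb hseg
  subst hb
  have hsum := sum_add_smul_eVec a t k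
  obtain ⟨ε, hε, m, hm, hml⟩ := hf.last
  simp only at hm hml
  rcases ht.eq_or_lt with rfl | ht
  · refine ⟨f, ⟨?_, ?_, ?_, ?_, ε, hε, m, ?_⟩, fun _ _ => rfl, ?_⟩
    · simpa using hf.le_sum
    · simpa using hf.apply_sum
    · simpa using hf.basic
    · simpa using hf.slopes
    · simpa using And.intro hm (hml.trans hlk)
    · intro q h1 h2
      have h3 : q = ∑ i, a i := le_antisymm (by simpa using h2) h1
      rw [h3, hf.apply_sum]
      simpa using hseg 0 le_rfl le_rfl
  set σ := ∑ i, a i with hσ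
  set g : ℝ → RVec n := fun q => if q ≤ σ then f q else a + (q - σ) • eVec n k with hg
  have hg1 : ∀ q, q ≤ σ → g q = f q := fun q hq => if_pos hq
  have hg2 : ∀ q, σ ≤ q → g q = a + (q - σ) • eVec n k := fun q hq => by
    rcases hq.eq_or_lt with rfl | hq
    · rw [hg1 _ le_rfl, hf.apply_sum]
      simp
    · exact if_neg (not_le.2 hq)
  have hg2' : ∀ q r, σ ≤ q → σ ≤ r → g r = g q + (r - q) • eVec n k := fun q r hq hr => by
    rw [hg2 q hq, hg2 r hr, add_assoc, ← add_smul]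
    congr 2
    ring
  have hgS : ∀ q, σ ≤ q → q ≤ σ + t → g q ∈ S := fun q h1 h2 => by
    rw [hg2 q h1]
    exact hseg _ (by linarith) (by linarith)
  have hcσ : c ≤ σ := hf.le_sum
  refine ⟨g, ⟨?_, ?_, ?_, ?_, t, ht, k, ?_, SlopeChange.of_le _ le_rfl⟩, hg1, ?_⟩
  · rw [hsum]
    linarith
  · rw [hsum, hg2 _ (by linarith)]
    simp
  · intro q h1 h2
    rw [hsum] at h2
    rcases le_total q σ with h3 | h3
    · rw [hg1 q h3]
      exact hf.basic q h1 h3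
    · refine ⟨(hS _ (hgS q h3 h2)).2, (hS _ (hgS q h3 h2)).1, ?_⟩
      rw [hg2 q h3, sum_add_smul_eVec]
      linarith
  · intro q h1 h2
    rw [hsum] at h2 ⊢
    rcases lt_trichotomy q σ with h3 | rfl | h3
    · obtain ⟨δ, hδ, hqδ, k', l', hL, hR, hlk'⟩ := hf.slopes q h1 h3
      simp only [← hσ] at hqδ
      refine ⟨δ, hδ, by linarith, k', l', fun r h4 h5 h6 => ?_, fun r h4 h5 => ?_, ?_⟩
      · rw [hg1 r (by linarith), hg1 q h3.le, hL r h4 h5 h6]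
      · rw [hg1 r (by linarith), hg1 q h3.le, hR r h4 h5]
      · rwa [hg1 q h3.le]
    · have hga : g σ = a := by rw [hg1 _ le_rfl, hf.apply_sum]
      refine ⟨min ε t, lt_min hε ht, by linarith [min_le_right ε t], k, m, fun r h4 h5 h6 => ?_,
        fun r h4 h5 => hg2' _ _ le_rfl h4, ?_⟩
      · rw [hg1 r h6, hga, hm r h4 (by linarith [min_le_left ε t]) h6]
      · rw [hga]
        exact hml.trans hlk
    · refine ⟨min (q - σ) (σ + t - q), lt_min (by linarith) (by linarith),
        by linarith [min_le_right (q - σ) (σ + t - q)], k, k, fun r h4 h5 h6 => ?_,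
        fun r h4 h5 => ?_, SlopeChange.of_le _ le_rfl⟩
      · exact hg2' _ _ h3.le (by linarith [min_le_left (q - σ) (σ + t - q)])
      · exact hg2' _ _ h3.le (by linarith)
  · intro r h1 h2 h3
    simp only [hsum] at h2 h3 ⊢
    rw [hg2 r (by linarith), add_assoc, ← add_smul]
    congr 2
    ring
  · intro q h1 h2
    simp only [hsum] at h2
    exact hgS q h1 h2

theorem IsPartialSystem.extend {c : ℝ} {s s' : RVec n × Fin n} {f : ℝ → RVec n}
    (hf : IsPartialSystem c s f) {S : Set (RVec n)} (hS : ∀ v ∈ S, Monotone v ∧ ∀ i, 0 ≤ v i)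
    (hsS : s.1 ∈ S) (h : RaisePath S s s') :
    ∃ g, IsPartialSystem c s' g ∧ (∀ q, q ≤ ∑ i, s.1 i → g q = f q) ∧
      ∀ q, ∑ i, s.1 i ≤ q → q ≤ ∑ i, s'.1 i → g q ∈ S := by
  induction h with
  | refl =>
    refine ⟨f, hf, fun _ _ => rfl, fun q h1 h2 => ?_⟩
    rw [le_antisymm h2 h1, hf.apply_sum]
    exact hsS
  | @tail r r' h1 h2 ih =>
    obtain ⟨g, hg, hgf, hgS⟩ := ih
    obtain ⟨g', hg', hgg', hgS'⟩ := hg.extend_step hS h2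
    have hle := RaisePath.sum_le h1
    refine ⟨g', hg', fun q hq => by rw [hgg' q (hq.trans hle), hgf q hq], fun q h3 h4 => ?_⟩
    rcases le_total q (∑ i, r.1 i) with h5 | h5
    · rw [hgg' q h5]
      exact hgS q h3 h5
    · exact hgS' q h5 h4

/-- Concatenation of infinitely many finite trajectories. -/
theorem exists_system_of_paths {S : ℕ → Set (RVec n)}
    (hS : ∀ i, ∀ v ∈ S i, Monotone v ∧ ∀ j, 0 ≤ v j) {s : ℕ → RVec n × Fin n}
    (hsS : ∀ i, (s i).1 ∈ S i) (h : ∀ i, RaisePath (S i) (s i) (s (i + 1)))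
    (hunb : ∀ M, ∃ i, M < ∑ j, (s i).1 j) :
    ∃ R : ℝ → RVec n, IsNSystem n (Set.Ici (∑ j, (s 0).1 j)) R ∧
      (∀ i, R (∑ j, (s i).1 j) = (s i).1) ∧
      ∀ i q, ∑ j, (s i).1 j ≤ q → q ≤ ∑ j, (s (i + 1)).1 j → R q ∈ S i := by
  set σ : ℕ → ℝ := fun i => ∑ j, (s i).1 j with hσ
  set c := σ 0 with hc
  have hmono : Monotone σ := monotone_nat_of_le_succ fun i => (h i).sum_le
  have hext : ∀ i, ∀ f : {f // IsPartialSystem c (s i) f},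
      ∃ g : {g // IsPartialSystem c (s (i + 1)) g}, (∀ q, q ≤ σ i → g.1 q = f.1 q) ∧
        ∀ q, σ i ≤ q → q ≤ σ (i + 1) → g.1 q ∈ S i := fun i f => by
    obtain ⟨g, hg, h1, h2⟩ := f.2.extend (hS i) (hsS i) (h i)
    exact ⟨⟨g, hg⟩, h1, h2⟩
  choose next hnext1 hnext2 using hext
  let F : ∀ i, {f // IsPartialSystem c (s i) f} := fun i =>
    Nat.rec ⟨_, IsPartialSystem.start (hS 0 _ (hsS 0)).2 (hS 0 _ (hsS 0)).1⟩ next i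
  have hF : ∀ i, F (i + 1) = next i (F i) := fun i => rfl
  have hagree : ∀ i j, i ≤ j → ∀ q, q ≤ σ i → (F j).1 q = (F i).1 q := by
    intro i j hij
    induction j, hij using Nat.le_induction with
    | base => exact fun _ _ => rfl
    | succ j hij ih =>
      intro q hq
      rw [hF, hnext1 j _ q (hq.trans (hmono hij)), ih q hq]
  choose N hN using hunb
  set R : ℝ → RVec n := fun q => (F (N q)).1 q with hR
  have hRF : ∀ i q, q ≤ σ i → R q = (F i).1 q := by
    intro i q hq
    rcases le_total i (N q) with h1 | h1
    · exact hagree _ _ h1 q hq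
    · exact (hagree _ _ h1 q (hN q).le).symm
  refine ⟨R, ⟨?_, Set.ordConnected_Ici, ?_, ?_⟩, ?_, ?_⟩
  · refine Set.Ici_subset_Ici.2 (Finset.sum_nonneg fun i _ => (hS 0 _ (hsS 0)).2 i)
  · rw [interior_Ici]
    exact Set.nonempty_Ioi
  · intro q hq
    have hq' : c ≤ q := hq
    have hlt := hN q
    set i := N q with hi
    refine ⟨(F i).2.basic q hq' hlt.le, ?_⟩
    obtain ⟨ε, hε, hqε, k, l, hL, hRt, hlk⟩ := (F i).2.slopes q hq' hlt
    rw [← hRF i q hlt.le] at hL hRt hlk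
    refine ⟨ε, hε, k, l, fun t ht => ?_, fun t ht => ?_, fun _ _ => hlk⟩
    · rw [hRF i t (ht.2.2.trans hlt.le)]
      exact hL t ht.1 ht.2.1 ht.2.2
    · rw [hRF i t (ht.2.2.trans hqε)]
      exact hRt t ht.2.1 ht.2.2
  · intro i
    rw [hRF i _ le_rfl]
    exact (F i).2.apply_sum
  · intro i q h1 h2
    rw [hRF (i + 1) q h2]
    exact hnext2 i (F i) q h1 h2

section UltrafilterLimit

variable {X : Type*} [MetricSpace X]

/-- The limit of the sets `F i` along the ultrafilter `U`. -/
def ultraLimit (U : Ultrafilter ℕ) (F : ℕ → Set X) : Set X :=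
  {z | ∀ ε > 0, ∀ᶠ i in (U : Filter ℕ), ∃ f ∈ F i, dist f z < ε}

theorem isClosed_ultraLimit (U : Ultrafilter ℕ) (F : ℕ → Set X) : IsClosed (ultraLimit U F) := by
  refine isClosed_of_closure_subset fun z hz ε hε => ?_
  obtain ⟨y, hy, hyz⟩ := Metric.mem_closure_iff.1 hz (ε / 2) (by linarith)
  filter_upwards [hy (ε / 2) (by linarith)] with i ⟨f, hf, hfy⟩
  refine ⟨f, hf, ?_⟩
  rw [dist_comm] at hyz
  linarith [dist_triangle f y z]

theorem exists_ultraLimit {U : Ultrafilter ℕ} {K : Set X} (hK : IsCompact K) {x : ℕ → X}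
    (hx : ∀ᶠ i in (U : Filter ℕ), x i ∈ K) :
    ∃ z, ∀ ε > 0, ∀ᶠ i in (U : Filter ℕ), dist (x i) z < ε := by
  obtain ⟨z, -, hz⟩ := hK.ultrafilter_le_nhds (U.map x) (by
    rw [Filter.le_principal_iff]
    exact hx)
  exact ⟨z, fun ε hε => (show Tendsto x U (𝓝 z) from hz).eventually (Metric.ball_mem_nhds z hε)⟩

theorem eventually_near_ultraLimit {U : Ultrafilter ℕ} {K : Set X} (hK : IsCompact K)
    {F : ℕ → Set X} (hF : ∀ i, F i ⊆ K) {δ : ℝ} (hδ : 0 < δ) :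
    ∀ᶠ i in (U : Filter ℕ), ∀ f ∈ F i, ∃ z ∈ ultraLimit U F, dist f z < δ := by
  by_contra hcon
  rw [← Ultrafilter.eventually_not] at hcon
  push Not at hcon
  have hne : Nonempty X := by
    obtain ⟨i, f, -⟩ := hcon.exists
    exact ⟨f⟩
  have hch : ∀ i, ∃ f : X, (∃ f ∈ F i, ∀ z ∈ ultraLimit U F, δ ≤ dist f z) →
      f ∈ F i ∧ ∀ z ∈ ultraLimit U F, δ ≤ dist f z := fun i => by
    by_cases h : ∃ f ∈ F i, ∀ z ∈ ultraLimit U F, δ ≤ dist f z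
    · obtain ⟨f, hf⟩ := h
      exact ⟨f, fun _ => hf⟩
    · exact ⟨hne.some, fun h' => absurd h' h⟩
  choose x hx using hch
  have hx' : ∀ᶠ i in (U : Filter ℕ), x i ∈ F i ∧ ∀ z ∈ ultraLimit U F, δ ≤ dist (x i) z := by
    filter_upwards [hcon] with i hi using hx i hi
  obtain ⟨z, hz⟩ := exists_ultraLimit (U := U) hK (hx'.mono fun i hi => hF i hi.1)
  have hzU : z ∈ ultraLimit U F := fun ε hε => by
    filter_upwards [hz ε hε, hx'] with i h1 h2 using ⟨x i, h2.1, h1⟩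
  obtain ⟨i, h1, h2⟩ := ((hz δ hδ).and hx').exists
  exact absurd (h2.2 z hzU) (not_le.2 h1)

end UltrafilterLimit

theorem setLiminf_subset_ultraLimit {U : Ultrafilter ℕ} (hU : (U : Filter ℕ) ≤ atTop)
    (F : ℕ → Set (RVec n)) : setLiminf n F ⊆ ultraLimit U F := by
  rintro z ⟨y, hy, hz⟩ ε hε
  filter_upwards [hU (hz.eventually (Metric.ball_mem_nhds z hε))] with i hi using ⟨y i, hy i, hi⟩

theorem ultraLimit_subset_setLimsup {U : Ultrafilter ℕ} (hU : (U : Filter ℕ) ≤ atTop)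
    {F : ℕ → Set (RVec n)} (hF : ∀ i, (F i).Nonempty) : ultraLimit U F ⊆ setLimsup n F := by
  intro z hz
  have hch : ∀ i, ∃ y ∈ F i, dist z y < Metric.infDist z (F i) + 1 / ((i : ℝ) + 1) := fun i =>
    (Metric.infDist_lt_iff (hF i)).1 (by linarith [Nat.one_div_pos_of_nat (α := ℝ) (n := i)])
  choose y hy hyd using hch
  have hlim : Tendsto y U (𝓝 z) := by
    rw [Metric.tendsto_nhds]
    intro ε hε
    have h1 : ∀ᶠ i : ℕ in (U : Filter ℕ), 1 / ((i : ℝ) + 1) < ε / 2 :=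
      hU (tendsto_one_div_add_atTop_nhds_zero_nat.eventually (gt_mem_nhds (by linarith)))
    filter_upwards [h1, hz (ε / 2) (by linarith)] with i h2 ⟨f, hf, hfz⟩
    rw [dist_comm]
    rw [dist_comm] at hfz
    linarith [hyd i, Metric.infDist_le_dist_of_mem (x := z) hf]
  have hclus : MapClusterPt z atTop y := by
    have : MapClusterPt z (U : Filter ℕ) y := hlim.mapClusterPt
    exact this.mono hU
  obtain ⟨φ, hφ, hφz⟩ := hclus.tendsto_subseq
  exact ⟨y, φ, hy, hφ, hφz⟩

variable (n) in
/-- The set of non-negative vectors of `ℝ^n` with non-decreasing coordinates of sum `1`. -/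
def orderedSimplex : Set (RVec n) := {v | (∀ i, 0 ≤ v i) ∧ Monotone v ∧ ∑ i, v i = 1}

theorem isCompact_orderedSimplex : IsCompact (orderedSimplex n) := by
  refine (isCompact_Icc (a := (0 : RVec n)) (b := 1)).of_isClosed_subset ?_ ?_
  · have h1 : IsClosed {v : RVec n | ∀ i, 0 ≤ v i} := by
      simp only [Set.ofPred_forall]
      exact isClosed_iInter fun i => isClosed_le continuous_const (continuous_apply i)
    have h2 : IsClosed {v : RVec n | Monotone v} := by
      simp only [Monotone, Set.ofPred_forall]
      exact isClosed_iInter fun i => isClosed_iInter fun j => isClosed_iInter fun _ =>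
        isClosed_le (continuous_apply i) (continuous_apply j)
    have h3 : IsClosed {v : RVec n | ∑ i, v i = 1} :=
      isClosed_eq (continuous_finsetSum _ fun i _ => continuous_apply i) continuous_const
    exact h1.inter (h2.inter h3)
  · rintro v ⟨h0, -, hs⟩
    refine ⟨h0, fun i => ?_⟩
    rw [Pi.one_apply, ← hs]
    exact Finset.single_le_sum (fun i _ => h0 i) (Finset.mem_univ _)

/-- The limit points at infinity of the directions of `P q` for `q ∈ A`. -/
def limitDirections (A : Set ℝ) (P : ℝ → RVec n) : Set (RVec n) :=
  {x | ∀ ε > 0, ∀ N : ℝ, ∃ q ∈ A, N < q ∧ dist (q⁻¹ • P q) x < ε}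

theorem FSet_eq_limitDirections (I : Set ℝ) (P : ℝ → RVec n) :
    FSet n I P = limitDirections I P := by
  ext x
  constructor
  · rintro ⟨q, hq, -, hqtop, hx⟩ ε hε N
    obtain ⟨i, h1, h2⟩ := ((hqtop.eventually_gt_atTop N).and
      (hx.eventually (Metric.ball_mem_nhds x hε))).exists
    exact ⟨q i, hq i, h1, h2⟩
  · intro hx
    have hx' : ∀ (k : ℕ) (N : ℝ), ∃ q ∈ I, N < q ∧ dist (q⁻¹ • P q) x < 1 / ((k : ℝ) + 1) :=
      fun k N => hx _ Nat.one_div_pos_of_nat N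
    choose f hfI hfN hfx using hx'
    let q : ℕ → ℝ := fun k => Nat.rec (f 0 0) (fun k r => f (k + 1) (max r (k + 1))) k
    have hq : ∀ k, q (k + 1) = f (k + 1) (max (q k) (k + 1)) := fun k => rfl
    have hqx : ∀ k, q k ∈ I ∧ dist ((q k)⁻¹ • P (q k)) x < 1 / ((k : ℝ) + 1) := by
      rintro (_ | k)
      · exact ⟨hfI _ _, hfx _ _⟩
      · rw [hq]
        exact ⟨hfI _ _, hfx _ _⟩
    refine ⟨q, fun k => (hqx k).1, strictMono_nat_of_lt_succ fun k => ?_, ?_, ?_⟩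
    · rw [hq]
      exact (le_max_left _ _).trans_lt (hfN _ _)
    · rw [← tendsto_add_atTop_iff_nat 1]
      refine tendsto_atTop_mono (fun k => ?_) tendsto_natCast_atTop_atTop
      rw [hq]
      have := (le_max_right (q k) ((k : ℝ) + 1)).trans_lt (hfN (k + 1) (max (q k) (k + 1)))
      linarith
    · rw [tendsto_iff_dist_tendsto_zero]
      exact squeeze_zero (fun _ => dist_nonneg) (fun k => (hqx k).2.le)
        tendsto_one_div_add_atTop_nhds_zero_nat

theorem IsNSystem.inv_smul_mem {I : Set ℝ} {P : ℝ → RVec n} (h : IsNSystem n I P) {q : ℝ}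
    (hq : q ∈ I) (h0 : 0 < q) : q⁻¹ • P q ∈ orderedSimplex n := by
  obtain ⟨⟨h1, h2, h3⟩, -⟩ := h.2.2.2 q hq
  have hq' : 0 ≤ q⁻¹ := (inv_pos.2 h0).le
  refine ⟨fun i => mul_nonneg hq' (h1 i), fun i j hij => mul_le_mul_of_nonneg_left (h2 hij) hq', ?_⟩
  simp only [Pi.smul_apply, smul_eq_mul, ← Finset.mul_sum, h3]
  exact inv_mul_cancel₀ h0.ne'

theorem limitDirections_mono {A B : Set ℝ} (hAB : A ⊆ B) (P : ℝ → RVec n) :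
    limitDirections A P ⊆ limitDirections B P := fun _ hx ε hε N => by
  obtain ⟨q, hq, h⟩ := hx ε hε N
  exact ⟨q, hAB hq, h⟩

theorem IsNSystem.limitDirections_subset {I A : Set ℝ} {P : ℝ → RVec n} (h : IsNSystem n I P)
    (hA : A ⊆ I) : limitDirections A P ⊆ orderedSimplex n := by
  intro x hx
  rw [← isCompact_orderedSimplex.isClosed.closure_eq, Metric.mem_closure_iff]
  intro ε hε
  obtain ⟨q, hq, h0, hd⟩ := hx ε hε 0
  exact ⟨_, h.inv_smul_mem (hA hq) h0, by rwa [dist_comm]⟩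

theorem IsNSystem.limitDirections_nonempty {I A : Set ℝ} {P : ℝ → RVec n} (h : IsNSystem n I P)
    (hA : A ⊆ I) (hunb : ∀ N, ∃ q ∈ A, N < q) : (limitDirections A P).Nonempty := by
  choose q hqA hq using hunb
  have hmem : ∀ k : ℕ, (q k)⁻¹ • P (q k) ∈ orderedSimplex n := fun k =>
    h.inv_smul_mem (hA (hqA k)) (k.cast_nonneg.trans_lt (hq k))
  obtain ⟨x, -, φ, hφ, hx⟩ := isCompact_orderedSimplex.tendsto_subseq hmem
  refine ⟨x, fun ε hε N => ?_⟩
  have hφ' : Tendsto (fun k => (φ k : ℝ)) atTop atTop :=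
    tendsto_natCast_atTop_atTop.comp hφ.tendsto_atTop
  obtain ⟨k, h1, h2⟩ := ((hφ'.eventually_gt_atTop N).and
    (hx.eventually (Metric.ball_mem_nhds x hε))).exists
  exact ⟨q (φ k), hqA _, h1.trans (hq _), h2⟩

theorem IsNSystem.exists_near_limitDirections {I : Set ℝ} {P : ℝ → RVec n}
    (h : IsNSystem n I P) {δ : ℝ} (hδ : 0 < δ) :
    ∃ Q, ∀ q ∈ I, Q < q → ∃ f ∈ limitDirections I P, dist (q⁻¹ • P q) f < δ := by
  by_contra! hcon
  set A : Set ℝ := {q | q ∈ I ∧ ∀ f ∈ limitDirections I P, δ ≤ dist (q⁻¹ • P q) f} with hA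
  have hAI : A ⊆ I := fun q hq => hq.1
  obtain ⟨x, hx⟩ := h.limitDirections_nonempty hAI fun N => by
    obtain ⟨q, hq, hN, hf⟩ := hcon N
    exact ⟨q, ⟨hq, hf⟩, hN⟩
  obtain ⟨q, hq, -, hd⟩ := hx δ hδ 0
  exact absurd (hq.2 x (limitDirections_mono hAI P hx)) (not_le.2 hd)

theorem RaisePath.mem {S : Set (RVec n)} {s s' : RVec n × Fin n} (h : RaisePath S s s')
    (hs : s.1 ∈ S) : s'.1 ∈ S := by
  induction h with
  | refl => exact hs
  | tail _ h2 _ =>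
    obtain ⟨-, t, ht, h3, h4⟩ := h2
    rw [h3]
    exact h4 t ht le_rfl

/-- The ordered non-negative vectors whose direction is close to a point of `G`. -/
def coneSet (G : Set (RVec n)) (ε : ℝ) : Set (RVec n) :=
  {v | (∀ j, 0 ≤ v j) ∧ Monotone v ∧ ∃ f ∈ G, ∃ τ > 0, ∀ j, |v j - τ * f j| ≤ 3 * ε * τ}

/-- The vector `x` with its small coordinates replaced by `ε`. -/
def floorVec (x : RVec n) (ε : ℝ) : RVec n := fun j => max (x j) ε

theorem orderedSimplex_le_one {x : RVec n} (hx : x ∈ orderedSimplex n) (j : Fin n) : x j ≤ 1 := by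
  rw [← hx.2.2]
  exact Finset.single_le_sum (fun i _ => hx.1 i) (Finset.mem_univ j)

theorem smul_floorVec_mem {G : Set (RVec n)} {x : RVec n} (hx : x ∈ orderedSimplex n) (hxG : x ∈ G)
    {L ε : ℝ} (hL : 0 < L) (hε : 0 < ε) : L • floorVec x ε ∈ coneSet G ε := by
  refine ⟨fun j => mul_nonneg hL.le (hε.le.trans (le_max_right _ _)), fun i j hij =>
    mul_le_mul_of_nonneg_left (max_le_max (hx.2.1 hij) le_rfl) hL.le, x, hxG, L, hL, fun j => ?_⟩
  have h1 : x j ≤ max (x j) ε := le_max_left _ _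
  have h2 : max (x j) ε ≤ x j + ε := max_le (by linarith) (by linarith [hx.1 j])
  simp only [Pi.smul_apply, smul_eq_mul, floorVec]
  rw [abs_le]
  constructor <;> nlinarith [mul_pos hL hε]

theorem abs_sub_mul_le_of_dist {v f : RVec n} {q δ : ℝ} (hq : 0 < q)
    (hd : dist (q⁻¹ • v) f ≤ δ) (j : Fin n) : |v j - q * f j| ≤ δ * q := by
  have h1 := (dist_le_pi_dist (q⁻¹ • v) f j).trans hd
  rw [Real.dist_eq, Pi.smul_apply, smul_eq_mul] at h1
  have h2 : v j - q * f j = q * (q⁻¹ * v j - f j) := by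
    field_simp
  rw [h2, abs_mul, abs_of_pos hq, mul_comm]
  exact mul_le_mul_of_nonneg_right h1 hq.le

/-- A scaled flattening of a long part of a system whose end points have direction close to `x`. -/
theorem exists_scaled_flattening {x a b : RVec n} {ε ε' δ q₁ q₂ L : ℝ} (hx : x ∈ orderedSimplex n)
    (hε' : 0 < ε') (hε : ε' ≤ ε) (hsep : ∀ i j, x i < x j → (1 + ε) ^ 2 * x i < x j)
    (hεx : ∀ j, x j ≠ 0 → ε ≤ x j) (hδε : (1 + ε) * δ ≤ ε')
    (hδx : ∀ j, x j ≠ 0 → (1 + ε) * δ ≤ ε * x j) (hL : 0 < L) (hq₁ : 0 < q₁)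
    (hq₂ : (1 + ε) ^ 2 * q₁ < ε' * q₂)
    (ha0 : ∀ j, 0 ≤ a j) (hb0 : ∀ j, 0 ≤ b j)
    (ha : ∀ j, |a j - q₁ * x j| ≤ δ * q₁) (hb : ∀ j, |b j - q₂ * x j| ≤ δ * q₂) :
    ∃ ψ : ℝ → ℝ, Monotone ψ ∧ (∀ y, 0 ≤ y → L * ε ≤ ψ y ∧
        |ψ y - L / q₁ * y| ≤ L / q₁ * (ε * y + ε * q₁)) ∧
      ψ ∘ a = L • floorVec x ε ∧
      (∀ j, x j ≠ 0 → ψ (b j) = L / q₁ * q₂ * x j) ∧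
      (∀ j, x j = 0 → ψ (b j) ≤ L / q₁ * q₂ * ε') := by
  have hε0 : 0 < ε := hε'.trans_le hε
  have hq1q2 : q₁ < q₂ := by
    by_contra! hcon
    nlinarith [mul_pos hε0 hq₁, mul_pos (mul_pos hε0 hε0) hq₁, mul_le_mul_of_nonneg_left hcon hε'.le]
  have hq₂0 : 0 < q₂ := hq₁.trans hq1q2
  have hc : 0 ≤ ε * q₁ := by positivity
  have hfar : ∀ i j, x i ≠ 0 → (1 + ε) ^ 2 * (q₁ * x j) < q₂ * x i := fun i j hi => by
    calc (1 + ε) ^ 2 * (q₁ * x j) ≤ (1 + ε) ^ 2 * (q₁ * 1) := by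
          gcongr
          exact orderedSimplex_le_one hx j
      _ < ε' * q₂ := by rwa [mul_one]
      _ ≤ x i * q₂ := by
          gcongr
          exact hε.trans (hεx i hi)
      _ = q₂ * x i := mul_comm _ _
  obtain ⟨φ, hφ, hφy, hφV⟩ := exists_monotone_flattening
    (Set.range (fun j => q₁ * x j) ∪ Set.range (fun j => q₂ * x j)) hc hε0
  have hsep' : ∀ i j, (1 + ε) ^ 2 * x j ≥ x i → x i ≤ x j := fun i j h => by
    by_contra! hcon
    linarith [hsep j i hcon]
  have hsq : 1 ≤ (1 + ε) ^ 2 := by nlinarith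
  have near : ∀ q y j, 0 < q → x j ≠ 0 → |y - q * x j| ≤ δ * q →
      q * x j ≤ (1 + ε) * y ∧ y ≤ (1 + ε) * (q * x j) := fun q y j hq hj hy => by
    have h1 := abs_le.1 hy
    have h2 := mul_le_mul_of_nonneg_right (hδx j hj) hq.le
    have h3 : (1 + ε) * δ * q = (1 + ε) * (δ * q) := by ring
    have h4 : ε * x j * q = ε * (q * x j) := by ring
    have h5 : 0 ≤ δ * q := (abs_nonneg _).trans hy
    have h6 : 0 ≤ ε * (δ * q) := by positivity
    constructor <;> nlinarith
  have ha1 : ∀ j, x j ≠ 0 → φ (a j) = q₁ * x j := fun j hj => by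
    obtain ⟨h1, h2⟩ := near q₁ (a j) j hq₁ hj (ha j)
    refine hφV _ (Or.inl ⟨j, rfl⟩) ?_ _ (ha0 j) h1 h2 ?_
    · rw [mul_comm]
      exact mul_le_mul_of_nonneg_left (hεx j hj) hq₁.le
    · rintro w (⟨i, rfl⟩ | ⟨i, rfl⟩) hw <;> simp only at hw ⊢
      · refine mul_le_mul_of_nonneg_left (hsep' i j ?_) hq₁.le
        refine le_of_mul_le_mul_left ?_ hq₁
        linarith
      · by_cases hi : x i = 0
        · rw [hi, mul_zero]
          exact mul_nonneg hq₁.le (hx.1 j)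
        · exact absurd (hfar i j hi) (not_lt.2 hw)
  have hb1 : ∀ j, x j ≠ 0 → φ (b j) = q₂ * x j := fun j hj => by
    obtain ⟨h1, h2⟩ := near q₂ (b j) j hq₂0 hj (hb j)
    refine hφV _ (Or.inr ⟨j, rfl⟩) ?_ _ (hb0 j) h1 h2 ?_
    · calc ε * q₁ ≤ x j * q₂ := mul_le_mul (hεx j hj) hq1q2.le hq₁.le (hx.1 j)
        _ = q₂ * x j := mul_comm _ _
    · rintro w (⟨i, rfl⟩ | ⟨i, rfl⟩) hw <;> simp only at hw ⊢
      · have h3 := hfar j i hj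
        have h4 : 0 ≤ q₁ * x i := mul_nonneg hq₁.le (hx.1 i)
        nlinarith
      · refine mul_le_mul_of_nonneg_left (hsep' i j ?_) hq₂0.le
        refine le_of_mul_le_mul_left ?_ hq₂0
        linarith
  have hsmall : ∀ q y j, 0 < q → 0 ≤ y → x j = 0 → |y - q * x j| ≤ δ * q →
      φ y ≤ max (ε * q₁) (ε' * q) := fun q y j hq hy0 hj hy => by
    refine (hφy y hy0).2.2.trans (max_le_max le_rfl ?_)
    rw [hj, mul_zero, sub_zero, abs_of_nonneg hy0] at hy
    calc (1 + ε) * y ≤ (1 + ε) * (δ * q) := by gcongr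
      _ = (1 + ε) * δ * q := by ring
      _ ≤ ε' * q := by gcongr
  have hμ : 0 < L / q₁ := div_pos hL hq₁
  have hμq : L / q₁ * q₁ = L := div_mul_cancel₀ _ hq₁.ne'
  refine ⟨fun y => L / q₁ * φ y, fun y z hyz => mul_le_mul_of_nonneg_left (hφ hyz) hμ.le,
    fun y hy => ⟨?_, ?_⟩, ?_, fun j hj => ?_, fun j hj => ?_⟩
  · calc L * ε = L / q₁ * (ε * q₁) := by rw [mul_comm ε, ← mul_assoc, hμq]
      _ ≤ L / q₁ * φ y := mul_le_mul_of_nonneg_left (hφy y hy).1 hμ.le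
  · rw [← mul_sub, abs_mul, abs_of_pos hμ]
    exact mul_le_mul_of_nonneg_left (hφy y hy).2.1 hμ.le
  · funext j
    simp only [Function.comp_apply, Pi.smul_apply, smul_eq_mul, floorVec]
    by_cases hj : x j = 0
    · have h1 := hsmall q₁ (a j) j hq₁ (ha0 j) hj (ha j)
      rw [max_eq_left (by gcongr)] at h1
      rw [h1.antisymm (hφy _ (ha0 j)).1, hj, max_eq_right hε0.le, mul_comm ε, ← mul_assoc, hμq]
    · rw [ha1 j hj, max_eq_left (hεx j hj), ← mul_assoc, hμq]
  · simp only
    rw [hb1 j hj, mul_assoc]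
  · have h1 := hsmall q₂ (b j) j hq₂0 (hb0 j) hj (hb j)
    rw [max_eq_right (by nlinarith)] at h1
    simp only
    rw [mul_assoc, mul_comm q₂]
    exact mul_le_mul_of_nonneg_left h1 hμ.le

/-- Rescaling and deforming a part of a proper system yields a trajectory inside `coneSet G ε`
which joins a multiple of `floorVec x ε` to a large multiple of `floorVec x ε'` and passes close to
the direction `z`. -/
theorem IsProperSys.exists_stage [NeZero n] {I : Set ℝ} {P : ℝ → RVec n} (hP : IsProperSys n I P)
    {G : Set (RVec n)} {x z : RVec n} {ε ε' δ : ℝ} (hx : x ∈ orderedSimplex n) (hxG : x ∈ G)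
    (hε' : 0 < ε') (hε : ε' ≤ ε) (hsep : ∀ i j, x i < x j → (1 + ε) ^ 2 * x i < x j)
    (hεx : ∀ j, x j ≠ 0 → ε ≤ x j) (hδ : δ ≤ ε) (hδε : (1 + ε) * δ ≤ ε')
    (hδx : ∀ j, x j ≠ 0 → (1 + ε) * δ ≤ ε * x j)
    (h1 : ∀ N, ∃ q ∈ I, HasRightSlope I P q 0 ∧ N < q ∧ dist (q⁻¹ • P q) x ≤ δ)
    (hz : ∀ N, ∃ q ∈ I, N < q ∧ dist (q⁻¹ • P q) z ≤ δ)
    (hG : ∃ Q, ∀ q ∈ I, Q < q → ∃ f ∈ G, dist (q⁻¹ • P q) f ≤ δ) {L : ℝ} (hL : 0 < L) (M : ℝ) :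
    ∃ (L' : ℝ) (w : RVec n × Fin n), 0 < L' ∧ M < L' ∧
      RaisePath (coneSet G ε) (L • floorVec x ε, 0) w ∧
      RaisePath (coneSet G ε) w (L' • floorVec x ε', 0) ∧
      ∃ τ > 0, ∀ j, |w.1 j - τ * z j| ≤ 3 * ε * τ := by
  have hε0 : 0 < ε := hε'.trans_le hε
  obtain ⟨Q, hQ⟩ := hG
  obtain ⟨q₁, hq₁I, hslope, hq₁, hq₁x⟩ := h1 (max Q 0)
  have hq₁0 : 0 < q₁ := (le_max_right _ _).trans_lt hq₁
  have hq₁Q : Q < q₁ := (le_max_left _ _).trans_lt hq₁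
  obtain ⟨p, hpI, hp, hpz⟩ := hz q₁
  have hp0 : 0 < p := hq₁0.trans hp
  obtain ⟨q₂, hq₂I, -, hq₂, hq₂x⟩ := h1 (max (max p (M * (q₁ / L)))
    (max (((1 + ε) * p + ε * q₁) / ε) ((1 + ε) ^ 2 * q₁ / ε')))
  simp only [max_lt_iff] at hq₂
  obtain ⟨⟨hpq, hM⟩, hpε, hq12⟩ := hq₂
  rw [div_lt_iff₀ hε0] at hpε
  rw [div_lt_iff₀ hε', mul_comm q₂] at hq12
  have hq₂0 : 0 < q₂ := hp0.trans hpq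
  have hPI : ∀ q ∈ I, (∀ j, 0 ≤ P q j) ∧ Monotone (P q) ∧ ∑ j, P q j = q := fun q hq =>
    (hP.1.2.2.2 q hq).1
  have hPle : ∀ q ∈ I, ∀ j, P q j ≤ q := fun q hq j => by
    conv_rhs => rw [← (hPI q hq).2.2]
    exact Finset.single_le_sum (fun i _ => (hPI q hq).1 i) (Finset.mem_univ j)
  obtain ⟨ψ, hψ, hψy, hψa, hψb, hψb0⟩ := exists_scaled_flattening hx hε' hε hsep hεx hδε hδx hL
    hq₁0 hq12 (hPI _ hq₁I).1 (hPI _ hq₂I).1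
    (abs_sub_mul_le_of_dist hq₁0 hq₁x) (abs_sub_mul_le_of_dist hq₂0 hq₂x)
  set μ := L / q₁ with hμdef
  have hμ : 0 < μ := div_pos hL hq₁0
  have hclose : ∀ q f v y, 0 < q → q₁ ≤ q → v ≤ q → |v - q * f| ≤ δ * q →
      |y - μ * v| ≤ μ * (ε * v + ε * q₁) → |y - μ * q * f| ≤ 3 * ε * (μ * q) := by
    intro q f v y hq0 hq hv hf hy
    have h2 : y - μ * q * f = (y - μ * v) + μ * (v - q * f) := by ring
    rw [h2]
    refine (abs_add_le _ _).trans ?_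
    rw [abs_mul, abs_of_pos hμ]
    calc |y - μ * v| + μ * |v - q * f| ≤ μ * (ε * q + ε * q) + μ * (ε * q) := by
          refine add_le_add (hy.trans ?_) (mul_le_mul_of_nonneg_left (hf.trans ?_) hμ.le)
          · gcongr
          · gcongr
      _ = 3 * ε * (μ * q) := by ring
  have hmap : ∀ {c d : ℝ} {k l : Fin n}, c ∈ I → q₁ ≤ c →
      RaisePath (P '' Set.Icc c d) (P c, k) (P d, l) →
      RaisePath (coneSet G ε) (ψ ∘ P c, k) (ψ ∘ P d, l) := by
    intro c d k l hc hqc hpath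
    refine RaisePath.map hψ (near := fun v y => 0 ≤ y ∧ |y - μ * v| ≤ μ * (ε * v + ε * q₁))
      ?_ ?_ ?_ hpath
    · intro a t ha ht y hay hyt
      have ha' := hψy a ha
      have hat := hψy (a + t) (by linarith)
      have hy0 : 0 ≤ y := (mul_pos hL hε0).le.trans (ha'.1.trans hay)
      rcases lt_or_ge y (μ * a) with hya | hya
      · refine ⟨0, le_rfl, ht, hy0, ?_⟩
        have h2 := (abs_le.1 ha'.2).1
        rw [add_zero, abs_of_neg (by linarith)]
        linarith
      rcases lt_or_ge (μ * (a + t)) y with hya' | hya'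
      · refine ⟨t, ht, le_rfl, hy0, ?_⟩
        have h2 := (abs_le.1 hat.2).2
        rw [abs_of_pos (by linarith)]
        linarith
      · refine ⟨y / μ - a, ?_, ?_, hy0, ?_⟩
        · rw [sub_nonneg, le_div_iff₀ hμ, mul_comm]
          exact hya
        · rw [sub_le_iff_le_add', div_le_iff₀ hμ, mul_comm]
          exact hya'
        · rw [add_sub_cancel, mul_div_cancel₀ _ hμ.ne', sub_self, abs_zero]
          have : 0 ≤ y / μ := div_nonneg hy0 hμ.le
          positivity
    · rintro _ ⟨q, hq, rfl⟩
      have := hPI q (hP.mem_of_le hc hq.1)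
      exact ⟨this.2.1, this.1⟩
    · rintro _ ⟨q, hq, rfl⟩ y hy hnear
      have hqI := hP.mem_of_le hc hq.1
      have hq1 : q₁ ≤ q := hqc.trans hq.1
      have hq0 : 0 < q := hq₁0.trans_le hq1
      obtain ⟨f, hf, hd⟩ := hQ q hqI (hq₁Q.trans_le hq1)
      exact ⟨fun j => (hnear j).1, hy, f, hf, μ * q, mul_pos hμ hq0, fun j =>
        hclose q (f j) (P q j) (y j) hq0 hq1 (hPle q hqI j) (abs_sub_mul_le_of_dist hq0 hd j)
          (hnear j).2⟩
  obtain ⟨k, hk, hpath1⟩ := hP.exists_path hq₁I hp.le ⟨0, hslope, SlopeChange.of_le _ le_rfl⟩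
  obtain ⟨l, -, hpath2⟩ := hP.exists_path hpI hpq.le hk
  have hm1 := hmap hq₁I le_rfl hpath1
  have hm2 := hmap hpI hp.le hpath2
  rw [hψa] at hm1
  have hwmem : ψ ∘ P p ∈ coneSet G ε := RaisePath.mem hm1 (smul_floorVec_mem hx hxG hL hε0)
  have hμq₂ : 0 < μ * q₂ := mul_pos hμ hq₂0
  refine ⟨μ * q₂, (ψ ∘ P p, k), hμq₂, ?_, hm1, ?_, μ * p, mul_pos hμ hp0, fun j =>
    hclose p (z j) (P p j) _ hp0 hp.le (hPle p hpI j) (abs_sub_mul_le_of_dist hp0 hpz j)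
      (hψy _ ((hPI p hpI).1 j)).2⟩
  · calc M = μ * (M * (q₁ / L)) := by
          rw [hμdef]
          field_simp
      _ < μ * q₂ := mul_lt_mul_of_pos_left hM hμ
  obtain ⟨r, hr, hrb, hpr, hor⟩ := RaisePath.backtrack hm2 (p := fun j => x j ≠ 0)
    (fun i j hij hi hj => hi (le_antisymm (by rw [← hj]; exact hx.2.1 hij) (hx.1 i)))
  have hrmem : r.1 ∈ coneSet G ε := RaisePath.mem hr hwmem
  have hval : ∀ j, x j ≠ 0 → r.1 j = μ * q₂ * x j := fun j hj => by
    rw [hpr j hj]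
    exact hψb j hj
  have hend : ∀ j, x j ≠ 0 → ((μ * q₂) • floorVec x ε') j = μ * q₂ * x j := fun j hj => by
    simp only [Pi.smul_apply, smul_eq_mul, floorVec]
    rw [max_eq_left (hε.trans (hεx j hj))]
  have hend0 : ∀ j, x j = 0 → ((μ * q₂) • floorVec x ε') j = μ * q₂ * ε' := fun j hj => by
    simp only [Pi.smul_apply, smul_eq_mul, floorVec]
    rw [hj, max_eq_right hε'.le]
  have hk : ∀ j, r.2 < j → x j ≠ 0 := by
    refine hor.resolve_right fun hrw => ?_
    obtain ⟨j, hj⟩ : ∃ j, x j ≠ 0 := by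
      by_contra! hcon
      have := hx.2.2
      simp [hcon] at this
    have h2 := hval j hj
    rw [hrw] at h2
    have h3 := (abs_le.1 (hψy (P p j) ((hPI p hpI).1 j)).2).2
    have h4 : q₂ * ε ≤ q₂ * x j := mul_le_mul_of_nonneg_left (hεx j hj) hq₂0.le
    have h5 : μ * ((1 + ε) * p + ε * q₁) < μ * (q₂ * x j) :=
      mul_lt_mul_of_pos_left (hpε.trans_le h4) hμ
    have h6 : μ * ((1 + ε) * P p j) ≤ μ * ((1 + ε) * p) := by
      gcongr
      exact hPle p hpI j
    simp only [Function.comp_apply] at h2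
    nlinarith
  refine hr.trans ?_
  refine raisePath_of_le ?_ r.2 r.1 hrmem.2.1 ?_ ?_ ?_
  · exact fun i j hij => mul_le_mul_of_nonneg_left (max_le_max (hx.2.1 hij) le_rfl) hμq₂.le
  · intro j
    by_cases hj : x j = 0
    · rw [hend0 j hj]
      exact (hrb j).trans (hψb0 j hj)
    · rw [hend j hj, hval j hj]
  · intro j hj
    rw [hend j (hk j hj), hval j (hk j hj)]
  · intro v hv hrv hvb
    refine ⟨fun j => (hrmem.1 j).trans (hrv j), hv, x, hxG, μ * q₂, hμq₂, fun j => ?_⟩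
    have h2 := hrv j
    have h3 := hvb j
    have h4 : 0 ≤ 3 * ε * (μ * q₂) := by positivity
    by_cases hj : x j = 0
    · rw [hend0 j hj] at h3
      rw [hj, mul_zero, sub_zero, abs_of_nonneg ((hrmem.1 j).trans h2)]
      nlinarith [mul_le_mul_of_nonneg_left hε hμq₂.le]
    · rw [hend j hj] at h3
      rw [hval j hj] at h2
      rw [h3.antisymm h2, sub_self, abs_zero]
      exact h4

theorem dist_inv_smul_le {v f : RVec n} {ε τ : ℝ} (hf : f ∈ orderedSimplex n) (hτ : 0 < τ)
    (hε0 : 0 ≤ ε) (hε : 6 * n * ε ≤ 1) (h : ∀ j, |v j - τ * f j| ≤ 3 * ε * τ) :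
    dist ((∑ j, v j)⁻¹ • v) f ≤ 6 * (n + 1) * ε := by
  set q := ∑ j, v j with hq
  have h1 : |q - τ| ≤ 3 * n * ε * τ := by
    have h2 : q - τ = ∑ j, (v j - τ * f j) := by
      rw [Finset.sum_sub_distrib, ← Finset.mul_sum, hf.2.2, mul_one]
    rw [h2]
    refine (Finset.abs_sum_le_sum_abs _ _).trans ((Finset.sum_le_sum fun j _ => h j).trans ?_)
    rw [Finset.sum_const, Finset.card_univ, Fintype.card_fin, nsmul_eq_mul]
    linarith
  have h2 : τ ≤ 2 * q := by
    have := (abs_le.1 h1).1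
    nlinarith
  have hq0 : 0 < q := by linarith
  rw [dist_pi_le_iff (by positivity)]
  intro j
  have h3 : q⁻¹ * v j - f j = q⁻¹ * ((v j - τ * f j) + (τ - q) * f j) := by
    field_simp
    ring
  rw [Real.dist_eq, Pi.smul_apply, smul_eq_mul, h3, abs_mul, abs_of_pos (inv_pos.2 hq0),
    inv_mul_le_iff₀ hq0]
  refine (abs_add_le _ _).trans ?_
  rw [abs_mul, abs_sub_comm, abs_of_nonneg (hf.1 j), abs_sub_comm τ]
  have h4 : |q - τ| * f j ≤ 3 * n * ε * τ := by
    calc |q - τ| * f j ≤ |q - τ| * 1 :=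
          mul_le_mul_of_nonneg_left (orderedSimplex_le_one hf j) (abs_nonneg _)
      _ ≤ 3 * n * ε * τ := by rwa [mul_one]
  have h5 := h j
  rw [abs_sub_comm] at h5
  calc |τ * f j - v j| + |q - τ| * f j ≤ 3 * ε * τ + 3 * n * ε * τ := add_le_add h5 h4
    _ = (3 * (n + 1) * ε) * τ := by ring
    _ ≤ (3 * (n + 1) * ε) * (2 * q) := by gcongr
    _ = q * (6 * (n + 1) * ε) := by ring

theorem exists_system_of_stages [NeZero n] {G : Set (RVec n)} (hGc : IsClosed G)
    (hG : G ⊆ orderedSimplex n) {x : RVec n} (hx : x ∈ G) {ε₀ : ℝ} (hε₀ : 0 < ε₀)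
    (hn : 6 * n * ε₀ ≤ 1)
    (hstage : ∀ z ∈ G, ∀ ε ε' : ℝ, 0 < ε' → ε' ≤ ε → ε ≤ ε₀ → ∀ L : ℝ, 0 < L → ∀ M : ℝ,
      ∃ (L' : ℝ) (w : RVec n × Fin n), 0 < L' ∧ M < L' ∧
        RaisePath (coneSet G ε) (L • floorVec x ε, 0) w ∧
        RaisePath (coneSet G ε) w (L' • floorVec x ε', 0) ∧
        ∃ τ > 0, ∀ j, |w.1 j - τ * z j| ≤ 3 * ε * τ) :
    ∃ (J : Set ℝ) (R : ℝ → RVec n), IsProperSys n J R ∧ FSet n J R = G := by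
  have : Nonempty G := ⟨x, hx⟩
  obtain ⟨u, hu⟩ := TopologicalSpace.exists_dense_seq G
  set ε : ℕ → ℝ := fun i => ε₀ / ((i : ℝ) + 1) with hεdef
  have hεpos : ∀ i, 0 < ε i := fun i => div_pos hε₀ (by positivity)
  have hεanti : Antitone ε := fun i j hij => by
    simp only [hεdef]
    gcongr
  have hεle : ∀ i, ε i ≤ ε₀ := fun i => (hεanti i.zero_le).trans_eq (by simp [hεdef])
  have hεn : ∀ i, 6 * n * ε i ≤ 1 := fun i => le_trans (by gcongr; exact hεle i) hn
  have hεlim : ∀ η > 0, ∃ i, 6 * (n + 1) * ε i < η := fun η hη => by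
    obtain ⟨i, hi⟩ := exists_nat_gt (6 * (n + 1) * ε₀ / η)
    refine ⟨i, ?_⟩
    rw [div_lt_iff₀ hη] at hi
    simp only [hεdef]
    rw [← mul_div_assoc, div_lt_iff₀ (by positivity)]
    nlinarith
  have hstep := fun (i : ℕ) (L : {L : ℝ // 0 < L}) =>
    hstage (u (Nat.unpair i).1) (u (Nat.unpair i).1).2 (ε i) (ε (i + 1)) (hεpos _)
      (hεanti i.le_succ) (hεle i) L.1 L.2 ((i + 1) / ε (i + 1))
  choose L' w hL'0 hL' hpath1 hpath2 hnear using hstep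
  let L : ℕ → {L : ℝ // 0 < L} := fun i =>
    Nat.rec ⟨1, one_pos⟩ (fun i L => ⟨L' i L, hL'0 i L⟩) i
  let s : ℕ → RVec n × Fin n := fun j =>
    if j % 2 = 0 then ((L (j / 2)).1 • floorVec x (ε (j / 2)), 0) else w (j / 2) (L (j / 2))
  have hs0 : ∀ i, s (2 * i) = ((L i).1 • floorVec x (ε i), 0) := fun i => by
    simp only [s]
    rw [if_pos (by omega), Nat.mul_div_cancel_left _ two_pos]
  have hs1 : ∀ i, s (2 * i + 1) = w i (L i) := fun i => by
    simp only [s]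
    rw [if_neg (by omega), show (2 * i + 1) / 2 = i by omega]
  let S : ℕ → Set (RVec n) := fun j => coneSet G (ε (j / 2))
  have hS0 : ∀ i, S (2 * i) = coneSet G (ε i) := fun i => by
    simp only [S]
    rw [Nat.mul_div_cancel_left _ two_pos]
  have hS1 : ∀ i, S (2 * i + 1) = coneSet G (ε i) := fun i => by
    simp only [S]
    rw [show (2 * i + 1) / 2 = i by omega]
  have hmem0 : ∀ i, (L i).1 • floorVec x (ε i) ∈ coneSet G (ε i) := fun i =>
    smul_floorVec_mem (hG hx) hx (L i).2 (hεpos i)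
  have hsS : ∀ j, (s j).1 ∈ S j := fun j => by
    obtain ⟨i, rfl | rfl⟩ := Nat.even_or_odd' j
    · rw [hs0, hS0]
      exact hmem0 i
    · rw [hs1, hS1]
      exact RaisePath.mem (hpath1 i (L i)) (hmem0 i)
  have hpath : ∀ j, RaisePath (S j) (s j) (s (j + 1)) := fun j => by
    obtain ⟨i, rfl | rfl⟩ := Nat.even_or_odd' j
    · rw [hs0, hS0, hs1]
      exact hpath1 i (L i)
    · rw [hs1, hS1, show 2 * i + 1 + 1 = 2 * (i + 1) by ring, hs0]
      exact hpath2 i (L i)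
  have hbig : ∀ i : ℕ, ∀ j, (i : ℝ) + 1 < (s (2 * (i + 1))).1 j := fun i j => by
    have h1 := hL' i (L i)
    rw [div_lt_iff₀ (hεpos _)] at h1
    rw [hs0]
    exact h1.trans_le (mul_le_mul_of_nonneg_left (le_max_right _ _) (L (i + 1)).2.le)
  have hunb : ∀ M, ∃ i, M < ∑ j, (s i).1 j := fun M => by
    obtain ⟨i, hi⟩ := exists_nat_gt M
    refine ⟨2 * (i + 1), ?_⟩
    have h0 : ∀ j, 0 ≤ (s (2 * (i + 1))).1 j := fun j =>
      le_trans (by positivity) (hbig i j).le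
    have h1 := Finset.single_le_sum (fun j _ => h0 j) (Finset.mem_univ (0 : Fin n))
    linarith [hbig i 0]
  obtain ⟨R, hR, hRs, hRS⟩ := exists_system_of_paths (S := S)
    (fun j v hv => ⟨hv.2.1, hv.1⟩) hsS hpath hunb
  set σ : ℕ → ℝ := fun i => ∑ j, (s i).1 j with hσ
  have hσmono : Monotone σ := monotone_nat_of_le_succ fun i => RaisePath.sum_le (hpath i)
  have hσJ : ∀ i, σ i ∈ Set.Ici (σ 0) := fun i => hσmono i.zero_le
  refine ⟨Set.Ici (σ 0), R, ⟨hR, fun M => ?_⟩, ?_⟩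
  · obtain ⟨i, hi⟩ := exists_nat_gt M
    refine ⟨σ (2 * (i + 1)), hσJ _, fun j => ?_⟩
    rw [hRs]
    linarith [hbig i j]
  rw [FSet_eq_limitDirections]
  refine Set.Subset.antisymm (fun y hy => ?_) (fun z hz η hη N => ?_)
  · rw [← hGc.closure_eq, Metric.mem_closure_iff]
    intro η hη
    obtain ⟨i, hi⟩ := hεlim (η / 2) (by linarith)
    obtain ⟨q, hqJ, hq, hqy⟩ := hy (η / 2) (by linarith) (σ (2 * i))
    have hex : ∃ k, q < σ k := hunb q
    classical
    obtain ⟨k, hk⟩ : ∃ k, Nat.find hex = k + 1 := Nat.exists_eq_succ_of_ne_zero fun h0 => by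
      have := Nat.find_spec hex
      rw [h0] at this
      exact absurd hqJ (not_le.2 this)
    have hk1 : q < σ (k + 1) := hk ▸ Nat.find_spec hex
    have hk0 : σ k ≤ q := not_lt.1 (Nat.find_min hex (by omega))
    have hik : 2 * i ≤ k := by
      by_contra! hcon
      exact absurd (hq.trans hk1) (not_lt.2 (hσmono hcon))
    obtain ⟨-, -, f, hf, τ, hτ, hτf⟩ := hRS k q hk0 hk1.le
    have hd := dist_inv_smul_le (hG hf) hτ (hεpos _).le (hεn _) hτf
    rw [(hR.2.2.2 q hqJ).1.2.2] at hd
    have hεk : 6 * (n + 1) * ε (k / 2) ≤ 6 * (n + 1) * ε i := by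
      gcongr
      exact hεanti (by omega)
    refine ⟨f, hf, ?_⟩
    rw [dist_comm] at hqy
    linarith [dist_triangle y (q⁻¹ • R q) f]
  · obtain ⟨i, hi⟩ := hεlim (η / 2) (by linarith)
    obtain ⟨k, hk⟩ := hunb N
    obtain ⟨y, hy, m, rfl⟩ := Metric.dense_iff.1 hu ⟨z, hz⟩ (η / 2) (by linarith)
    have hyz : dist (u m : RVec n) z < η / 2 := hy
    set j := Nat.pair m (max i k) with hj
    have hjm : (Nat.unpair j).1 = m := by rw [hj, Nat.unpair_pair]
    have hjle : max i k ≤ j := Nat.right_le_pair _ _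
    obtain ⟨τ, hτ, hτz⟩ := hnear j (L j)
    have hd := dist_inv_smul_le (hG (u _).2) hτ (hεpos _).le (hεn _) hτz
    rw [hjm] at hd
    have hεj : 6 * (n + 1) * ε j ≤ 6 * (n + 1) * ε i := by
      gcongr
      exact hεanti ((le_max_left _ _).trans hjle)
    refine ⟨σ (2 * j + 1), hσJ _, hk.trans_le (hσmono ?_), ?_⟩
    · have := (le_max_right i k).trans hjle
      omega
    · rw [hRs, hσ]
      simp only [hs1]
      linarith [dist_triangle ((∑ a, (w j (L j)).1 a)⁻¹ • (w j (L j)).1) (u m : RVec n) z]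

theorem exists_separation (x : RVec n) (hx : ∀ j, 0 ≤ x j) :
    ∃ ε₀ > (0 : ℝ), ε₀ ≤ 1 ∧ 6 * n * ε₀ ≤ 1 ∧ ∀ ε, 0 < ε → ε ≤ ε₀ →
      (∀ i j, x i < x j → (1 + ε) ^ 2 * x i < x j) ∧ ∀ j, x j ≠ 0 → ε ≤ x j := by
  have hlim : ∀ {f : ℝ → ℝ} {c : ℝ}, Continuous f → f 0 < c → ∀ᶠ ε in 𝓝[>] (0 : ℝ), f ε < c :=
    fun hf h => (hf.continuousAt.eventually (gt_mem_nhds h)).filter_mono nhdsWithin_le_nhds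
  have h1 : ∀ᶠ ε in 𝓝[>] (0 : ℝ), ∀ i j, x i < x j → (1 + ε) ^ 2 * x i < x j := by
    simp only [eventually_all]
    exact fun i j h => hlim (by fun_prop) (by simpa using h)
  have h2 : ∀ᶠ ε in 𝓝[>] (0 : ℝ), ∀ j, x j ≠ 0 → ε < x j := by
    simp only [eventually_all]
    exact fun j h => hlim (by fun_prop) ((hx j).lt_of_ne' h)
  have h3 : ∀ᶠ ε in 𝓝[>] (0 : ℝ), ε < 1 := hlim (by fun_prop) one_pos
  have h4 : ∀ᶠ ε : ℝ in 𝓝[>] (0 : ℝ), 6 * n * ε < 1 := hlim (by fun_prop) (by simp)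
  obtain ⟨ε₀, hε₀, h⟩ := (mem_nhdsGT_iff_exists_Ioc_subset).1 (h1.and (h2.and (h3.and h4)))
  refine ⟨ε₀, hε₀, ?_, ?_, fun ε h0 hle => ?_⟩
  · exact (h ⟨hε₀, le_rfl⟩).2.2.1.le
  · exact (h ⟨hε₀, le_rfl⟩).2.2.2.le
  · have := h ⟨h0, hle⟩
    exact ⟨this.1, fun j hj => (this.2.1 j hj).le⟩

theorem exists_FSet_eq_ultraLimit [NeZero n] (U : Ultrafilter ℕ) {I : ℕ → Set ℝ}
    {P : ℕ → ℝ → RVec n} (hP : ∀ i, IsProperSys n (I i) (P i)) :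
    ∃ (J : Set ℝ) (R : ℝ → RVec n), IsProperSys n J R ∧
      FSet n J R = ultraLimit U fun i => FSet n (I i) (P i) := by
  simp only [FSet_eq_limitDirections (I _)]
  set F : ℕ → Set (RVec n) := fun i => limitDirections (I i) (P i) with hF
  set G := ultraLimit U F with hGdef
  have hFK : ∀ i, F i ⊆ orderedSimplex n := fun i => (hP i).1.limitDirections_subset subset_rfl
  have hGK : G ⊆ orderedSimplex n := fun z hz => by
    rw [← isCompact_orderedSimplex.isClosed.closure_eq, Metric.mem_closure_iff]
    intro η hη
    obtain ⟨i, f, hf, hfz⟩ := (hz η hη).exists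
    exact ⟨f, hFK i hf, by rwa [dist_comm]⟩
  set A : ℕ → Set ℝ := fun i => {q | q ∈ I i ∧ HasRightSlope (I i) (P i) q 0} with hA
  have hAI : ∀ i, A i ⊆ I i := fun i q hq => hq.1
  have hne : ∀ i, (limitDirections (A i) (P i)).Nonempty := fun i =>
    (hP i).1.limitDirections_nonempty (hAI i) fun N => by
      obtain ⟨q, hq, hN, hs⟩ := (hP i).exists_right_slope_zero N
      exact ⟨q, ⟨hq, hs⟩, hN⟩
  choose y hy using hne
  have hyF : ∀ i, y i ∈ F i := fun i => limitDirections_mono (hAI i) _ (hy i)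
  obtain ⟨x, hx⟩ := exists_ultraLimit (U := U) isCompact_orderedSimplex
    (Eventually.of_forall fun i => hFK i (hyF i))
  have hxG : x ∈ G := fun η hη => (hx η hη).mono fun i hi => ⟨y i, hyF i, hi⟩
  obtain ⟨ε₀, hε₀, hε₀1, hn, hsep⟩ := exists_separation x (hGK hxG).1
  refine exists_system_of_stages (isClosed_ultraLimit U F) hGK hxG hε₀ hn ?_
  intro z hz ε ε' hε' hε hεε₀ L hL M
  have hε0 := hε'.trans_le hε
  obtain ⟨hsep1, hsep2⟩ := hsep ε hε0 hεε₀
  set δ := min (ε' / 2) (ε ^ 2 / 2) with hδ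
  have hδ0 : 0 < δ := lt_min (by positivity) (by positivity)
  have hδ1 : δ ≤ ε' / 2 := min_le_left _ _
  have hδ2 : δ ≤ ε ^ 2 / 2 := min_le_right _ _
  have hδ3 : (1 + ε) * δ ≤ 2 * δ := by
    gcongr
    linarith
  obtain ⟨i, hi1, ⟨f, hf, hfz⟩, hi3⟩ := ((hx (δ / 2) (half_pos hδ0)).and
    ((hz (δ / 2) (half_pos hδ0)).and
      (eventually_near_ultraLimit isCompact_orderedSimplex hFK (half_pos hδ0)))).exists
  refine (hP i).exists_stage (δ := δ) (hGK hxG) hxG hε' hε hsep1 hsep2 (by linarith) (by linarith)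
    (fun j hj => ?_) (fun N => ?_) (fun N => ?_) ?_ hL M
  · have := mul_le_mul_of_nonneg_left (hsep2 j hj) hε0.le
    nlinarith
  · obtain ⟨q, hq, hN, hd⟩ := hy i (δ / 2) (half_pos hδ0) N
    exact ⟨q, hq.1, hq.2, hN, by linarith [dist_triangle (q⁻¹ • P i q) (y i) x]⟩
  · obtain ⟨q, hq, hN, hd⟩ := hf (δ / 2) (half_pos hδ0) N
    exact ⟨q, hq, hN, by linarith [dist_triangle (q⁻¹ • P i q) f z]⟩
  · obtain ⟨Q, hQ⟩ := (hP i).1.exists_near_limitDirections (half_pos hδ0)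
    refine ⟨Q, fun q hq hQq => ?_⟩
    obtain ⟨g, hg, hgd⟩ := hQ q hq hQq
    obtain ⟨v, hv, hvd⟩ := hi3 g hg
    exact ⟨v, hv, by linarith [dist_triangle (q⁻¹ • P i q) g v]⟩

end Trajectories

/-- **Corollary (limit of a sequence of systems).** For any sequence of proper
`n`-systems `P⁽ⁱ⁾` there is a proper `n`-system `R` with
`liminf_i F(P⁽ⁱ⁾) ⊆ F(R) ⊆ limsup_i F(P⁽ⁱ⁾)`. -/
theorem squeeze_FSet (n : ℕ) (hn : 2 ≤ n)
    (I : ℕ → Set ℝ) (P : ℕ → ℝ → RVec n)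
    (hP : ∀ i, IsProperSys n (I i) (P i)) :
    ∃ (J : Set ℝ) (R : ℝ → RVec n), IsProperSys n J R ∧
      setLiminf n (fun i => FSet n (I i) (P i)) ⊆ FSet n J R ∧
      FSet n J R ⊆ setLimsup n (fun i => FSet n (I i) (P i)) := by
  have : NeZero n := ⟨by omega⟩
  obtain ⟨J, R, hR, hF⟩ := exists_FSet_eq_ultraLimit (hyperfilter ℕ) hP
  have hU : ((hyperfilter ℕ : Ultrafilter ℕ) : Filter ℕ) ≤ atTop := Nat.hyperfilter_le_atTop
  refine ⟨J, R, hR, ?_, ?_⟩ <;> rw [hF]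
  · exact setLiminf_subset_ultraLimit hU _
  · refine ultraLimit_subset_setLimsup hU fun i => ?_
    rw [FSet_eq_limitDirections]
    exact (hP i).1.limitDirections_nonempty subset_rfl (hP i).exists_gt
end
end
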